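/- arXiv:1211.5217 — 2 statements merged into one kernel-verified Lean document; each statement's English description precedes it below -/
import Mathlib

section
/- Let a, b > 0 with a − 2b > 0, η ∈ (0, √(a−b) − √(a/2)), φ_η an admissible cutoff, and k ∈ ℕ. Then there exists ε ∈ (0,1) such that A_k ∪ I_k ⊂ (0, 1 − ε), where A_k = {x ∈ (0,1) : lim_{r→+∞} H(f_{x,η}, g_{x,η})(r) < 0 and g_{x,η} changes sign exactly k times on (0,∞)} and I_k = {x ∈ (0,1) : (f_{x,η}, g_{x,η})(r) → (0,0) as r → +∞ and g_{x,η} changes sign exactly k times on (0,∞)}. -/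
open Real Set Filter Topology

noncomputable section

/-- The Hamiltonian energy `H(f,g) = ½ f²(1−g²) + (a/4) g⁴ − (b/2) g²`. -/
def Ham (a b f g : ℝ) : ℝ := 1 / 2 * f ^ 2 * (1 - g ^ 2) + a / 4 * g ^ 4 - b / 2 * g ^ 2

/-- The set `𝒜` of admissible points. -/
def Aadm (a b : ℝ) : Set (ℝ × ℝ) :=
  {p | 2 * p.1 ^ 2 - a * p.2 ^ 2 - (a - 2 * b) ≤ 0 ∧ p.2 ^ 2 ≤ 1}

/-- `φ` is an admissible cutoff function `φ_η`. -/
def IsCutoff (a b η : ℝ) (φ : ℝ → ℝ → ℝ) : Prop :=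
  (∀ f g, φ f g ∈ Icc (0 : ℝ) 1) ∧
  ContDiffOn ℝ (⊤ : ℕ∞) (fun p : ℝ × ℝ => φ p.1 p.2)
    (Ioo (-Real.sqrt (a - b)) (Real.sqrt (a - b)) ×ˢ (univ : Set ℝ)) ∧
  (∀ f g, φ f g = φ |f| |g|) ∧
  (∀ f g, Real.sqrt (a - b) - η / 2 ≤ |f| → φ f g = 0) ∧
  (∀ f g, |f| ≤ Real.sqrt (a - b) - η → φ f g = 1)

/-- `(f, g)` is a `C¹` solution on `s` of the original Cauchy problem
`f' + (2/r) f = g(f² − a g² + b)`, `g' = f(1 − g²)`, `f(0) = 0`, `g(0) = x`. -/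
def IsSolOn (a b x : ℝ) (f g : ℝ → ℝ) (s : Set ℝ) : Prop :=
  f 0 = 0 ∧ g 0 = x ∧ ContinuousOn f s ∧ ContinuousOn g s ∧
  ∀ r ∈ s, 0 < r →
    HasDerivAt f (g r * ((f r) ^ 2 - a * (g r) ^ 2 + b) - 2 / r * f r) r ∧
    HasDerivAt g (f r * (1 - (g r) ^ 2)) r

/-- `(f, g)` is a `C¹` solution on `s` of the regularized Cauchy problem
`f' + (2 φ(f,g)/r) f = g(f² − a g² + b)`, `g' = f(1 − g²)`, `f(0) = 0`, `g(0) = x`. -/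
def IsRegSolOn (a b : ℝ) (φ : ℝ → ℝ → ℝ) (x : ℝ) (f g : ℝ → ℝ) (s : Set ℝ) : Prop :=
  f 0 = 0 ∧ g 0 = x ∧ ContinuousOn f s ∧ ContinuousOn g s ∧
  ∀ r ∈ s, 0 < r →
    HasDerivAt f (g r * ((f r) ^ 2 - a * (g r) ^ 2 + b) - 2 * φ (f r) (g r) / r * f r) r ∧
    HasDerivAt g (f r * (1 - (g r) ^ 2)) r

/-- `(f, g)` is a solution on `s` of the autonomous (Hamiltonian) system
`f' = g(f² − a g² + b)`, `g' = f(1 − g²)` with initial data `(fi, gi)`. -/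
def IsAutSolOn (a b fi gi : ℝ) (f g : ℝ → ℝ) (s : Set ℝ) : Prop :=
  f 0 = fi ∧ g 0 = gi ∧ ContinuousOn f s ∧ ContinuousOn g s ∧
  ∀ r ∈ s,
    HasDerivAt f (g r * ((f r) ^ 2 - a * (g r) ^ 2 + b)) r ∧
    HasDerivAt g (f r * (1 - (g r) ^ 2)) r

/-- `(f, g)` is a solution on `s` of the shifted regularized system
`f' + (2 φ(f,g)/(ρ+r)) f = g(f² − a g² + b)`, `g' = f(1 − g²)` with initial data `(fi, gi)`. -/
def IsShiftSolOn (a b : ℝ) (φ : ℝ → ℝ → ℝ) (ρ fi gi : ℝ) (f g : ℝ → ℝ) (s : Set ℝ) : Prop :=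
  f 0 = fi ∧ g 0 = gi ∧ ContinuousOn f s ∧ ContinuousOn g s ∧
  ∀ r ∈ s,
    HasDerivAt f (g r * ((f r) ^ 2 - a * (g r) ^ 2 + b) - 2 * φ (f r) (g r) / (ρ + r) * f r) r ∧
    HasDerivAt g (f r * (1 - (g r) ^ 2)) r

/-- The interval `[0, R)` with possibly infinite right endpoint. -/
def edom (R : EReal) : Set ℝ := {r : ℝ | 0 ≤ r ∧ (r : EReal) < R}

/-- `g` changes sign at `r₀` relative to the interval `s`. -/
def ChangesSignAt (g : ℝ → ℝ) (s : Set ℝ) (r₀ : ℝ) : Prop :=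
  g r₀ = 0 ∧ ∃ ε > 0, Icc (r₀ - ε) (r₀ + ε) ⊆ s ∧
    g (r₀ - ε) * g (r₀ + ε) < 0 ∧ ∀ r ∈ Ioo (0 : ℝ) ε, g (r₀ - r) * g (r₀ + r) ≤ 0

/-- `g` changes sign exactly `k` times on `s`. -/
def ChangesSignExactly (g : ℝ → ℝ) (s : Set ℝ) (k : ℕ) : Prop :=
  {r | ChangesSignAt g s r}.Finite ∧ {r | ChangesSignAt g s r}.ncard = k

/-- The set `A_k`, for the family of solutions `x ↦ (F x, G x)`. -/
def Aset (a b : ℝ) (F G : ℝ → ℝ → ℝ) (k : ℕ) : Set ℝ :=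
  {x | x ∈ Ioo (0 : ℝ) 1 ∧
    (∃ L, L < 0 ∧ Tendsto (fun r => Ham a b (F x r) (G x r)) atTop (nhds L)) ∧
    ChangesSignExactly (G x) (Ioi 0) k}

/-- The set `I_k`, for the family of solutions `x ↦ (F x, G x)`. -/
def Iset (a b : ℝ) (F G : ℝ → ℝ → ℝ) (k : ℕ) : Set ℝ :=
  {x | x ∈ Ioo (0 : ℝ) 1 ∧
    Tendsto (fun r => (F x r, G x r)) atTop (nhds ((0 : ℝ), (0 : ℝ))) ∧
    ChangesSignExactly (G x) (Ioi 0) k}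

/-- A continuous function with nonnegative derivative inside an interval increases between its
endpoints. -/
lemma le_of_hasDerivAt_nonneg {u u' : ℝ → ℝ} {s t : ℝ} (hst : s ≤ t)
    (hc : ContinuousOn u (Icc s t)) (hd : ∀ r ∈ Ioo s t, HasDerivAt u (u' r) r)
    (hn : ∀ r ∈ Ioo s t, 0 ≤ u' r) : u s ≤ u t := by
  refine monotoneOn_of_hasDerivWithinAt_nonneg (f' := u') (convex_Icc s t) hc ?_ ?_
    (left_mem_Icc.2 hst) (right_mem_Icc.2 hst) hst
  · intro r hr
    rw [interior_Icc] at hr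
    exact (hd r hr).hasDerivWithinAt
  · intro r hr
    rw [interior_Icc] at hr
    exact hn r hr

/-- A function starting nonpositive and strictly decreasing at each of its zeros stays
nonpositive. -/
lemma nonpos_of_deriv_neg_at_zeros {u u' : ℝ → ℝ} {s t : ℝ}
    (hd : ∀ r ∈ Icc s t, HasDerivAt u (u' r) r) (hn : ∀ r ∈ Icc s t, u r = 0 → u' r < 0)
    (hs : u s ≤ 0) : ∀ r ∈ Icc s t, u r ≤ 0 := by
  intro r hr
  refine image_le_of_deriv_right_lt_deriv_boundary' (f := u) (f' := u') (B := fun _ => 0)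
    (B' := fun _ => 0) (fun r hr => (hd r hr).continuousAt.continuousWithinAt)
    (fun r hr => (hd r (Ico_subset_Icc_self hr)).hasDerivWithinAt) hs continuousOn_const
    (fun r _ => hasDerivWithinAt_const _ _ _) ?_ hr
  exact fun r hr h => hn r (Ico_subset_Icc_self hr) h

/-- A function strictly decreasing at each of its zeros changes sign at most once. -/
lemma exists_sign_split {u u' : ℝ → ℝ} {s t : ℝ} (hst : s ≤ t)
    (hd : ∀ r ∈ Icc s t, HasDerivAt u (u' r) r) (hn : ∀ r ∈ Icc s t, u r = 0 → u' r < 0) :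
    ∃ z ∈ Icc s t, (∀ r ∈ Ioo s z, 0 ≤ u r) ∧ ∀ r ∈ Ioo z t, u r ≤ 0 := by
  have hc : ContinuousOn u (Icc s t) := fun r hr => (hd r hr).continuousAt.continuousWithinAt
  by_cases hz : ∃ z ∈ Icc s t, u z = 0
  · obtain ⟨z, hz, hz0⟩ := hz
    refine ⟨z, hz, fun r hr => ?_, fun r hr => ?_⟩
    · have hneg : ∀ r ∈ Icc (-z) (-s), -u (-r) ≤ 0 := by
        refine nonpos_of_deriv_neg_at_zeros (u' := fun r => u' (-r)) ?_ ?_ ?_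
        · intro r hr
          have := (hd (-r) ⟨by linarith [hr.2], by linarith [hr.1, hz.2]⟩).scomp r
            (hasDerivAt_neg r)
          simpa [Function.comp_def] using this.fun_neg
        · intro r hr h0
          exact hn _ ⟨by linarith [hr.2], by linarith [hr.1, hz.2]⟩ (by linarith)
        · simp [hz0]
      have := hneg (-r) ⟨by linarith [hr.2], by linarith [hr.1]⟩
      rw [neg_neg] at this
      linarith
    · exact nonpos_of_deriv_neg_at_zeros (fun r hr => hd r ⟨hz.1.trans hr.1, hr.2⟩)
        (fun r hr => hn r ⟨hz.1.trans hr.1, hr.2⟩) hz0.le r (Ioo_subset_Icc_self hr)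
  · rcases le_or_gt (u s) 0 with hs | hs
    · exact ⟨s, left_mem_Icc.2 hst, fun r hr => absurd hr.1 (not_lt.2 hr.2.le), fun r hr =>
        nonpos_of_deriv_neg_at_zeros hd hn hs r (Ioo_subset_Icc_self hr)⟩
    · refine ⟨t, right_mem_Icc.2 hst, fun r hr => ?_, fun r hr => absurd hr.1 (not_lt.2 hr.2.le)⟩
      by_contra! hr0
      obtain ⟨z, hz1, hz2⟩ := intermediate_value_Icc' hr.1.le
        (hc.mono (Icc_subset_Icc_right hr.2.le)) ⟨hr0.le, hs.le⟩
      exact hz ⟨z, ⟨hz1.1, hz1.2.trans hr.2.le⟩, hz2⟩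

/-- A function with nonzero derivative at a zero changes sign there. -/
lemma ChangesSignAt.of_hasDerivAt {g : ℝ → ℝ} {g' r₀ : ℝ} (hr₀ : 0 < r₀)
    (hd : HasDerivAt g g' r₀) (h0 : g r₀ = 0) (hg' : g' ≠ 0) : ChangesSignAt g (Ioi 0) r₀ := by
  have hlim := (hasDerivAt_iff_tendsto_slope.1 hd).mul_const g'
  have hev := hlim.eventually (lt_mem_nhds (mul_self_pos.2 hg'))
  rw [eventually_nhdsWithin_iff, Metric.eventually_nhds_iff] at hev
  obtain ⟨δ, hδ, hev⟩ := hev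
  have key : ∀ r, 0 < r → r < δ → g (r₀ - r) * g (r₀ + r) < 0 := by
    intro r hr hrδ
    have h1 := @hev (r₀ - r) (by simp [abs_of_pos hr, hrδ]) (by simp [hr.ne'])
    have h2 := @hev (r₀ + r) (by simp [abs_of_pos hr, hrδ]) (by simp [hr.ne'])
    simp only [slope_def_field, h0, sub_zero, add_sub_cancel_left, sub_sub_cancel_left] at h1 h2
    have h3 := mul_pos h1 h2
    have h4 : g (r₀ - r) / -r * g' * (g (r₀ + r) / r * g')
        = -(g (r₀ - r) * g (r₀ + r)) * (g' ^ 2 / r ^ 2) := by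
      field_simp
    rw [h4] at h3
    have := pos_of_mul_pos_left h3 (by positivity)
    linarith
  refine ⟨h0, min (δ / 2) (r₀ / 2), by positivity, fun r hr => ?_, key _ (by positivity) ?_,
    fun r hr => (key r hr.1 ?_).le⟩
  · have := min_le_right (δ / 2) (r₀ / 2)
    exact lt_of_lt_of_le (by linarith) hr.1
  · exact (min_le_left _ _).trans_lt (by linarith)
  · have := min_le_left (δ / 2) (r₀ / 2)
    linarith [hr.2]

lemma ham_neg (a b f g : ℝ) : Ham a b (-f) (-g) = Ham a b f g := by
  unfold Ham
  ring

/-- `(f, g)` solves the Hamiltonian system with an additional friction term `-p f`, where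
`0 ≤ p r ≤ 2 / r`, and starts on the segment joining `(0, -1)` to `(0, 1)`. -/
structure IsDampedSol (a b : ℝ) (p f g : ℝ → ℝ) : Prop where
  pos_a : 0 < a
  pos_b : 0 < b
  two_mul_lt : 2 * b < a
  init_f : f 0 = 0
  init_g : g 0 ^ 2 < 1
  cont_f : ContinuousOn f (Ici 0)
  cont_g : ContinuousOn g (Ici 0)
  p_nonneg : ∀ r, 0 < r → 0 ≤ p r
  p_le : ∀ r, 0 < r → p r ≤ 2 / r
  deriv_f : ∀ r, 0 < r → HasDerivAt f (g r * (f r ^ 2 - a * g r ^ 2 + b) - p r * f r) r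
  deriv_g : ∀ r, 0 < r → HasDerivAt g (f r * (1 - g r ^ 2)) r

namespace IsDampedSol

variable {a b : ℝ} {p f g : ℝ → ℝ}

lemma neg (h : IsDampedSol a b p f g) : IsDampedSol a b p (fun r => -f r) (fun r => -g r) where
  pos_a := h.pos_a
  pos_b := h.pos_b
  two_mul_lt := h.two_mul_lt
  init_f := by simp [h.init_f]
  init_g := by simpa using h.init_g
  cont_f := h.cont_f.neg
  cont_g := h.cont_g.neg
  p_nonneg := h.p_nonneg
  p_le := h.p_le
  deriv_f r hr := by
    refine (h.deriv_f r hr).fun_neg.congr_deriv ?_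
    ring
  deriv_g r hr := by
    refine (h.deriv_g r hr).fun_neg.congr_deriv ?_
    ring

lemma hasDerivAt_ham (h : IsDampedSol a b p f g) {r : ℝ} (hr : 0 < r) :
    HasDerivAt (fun r => Ham a b (f r) (g r)) (-(p r * f r ^ 2 * (1 - g r ^ 2))) r := by
  have hf := h.deriv_f r hr
  have hg := h.deriv_g r hr
  have := ((((hf.pow 2).const_mul (1 / 2)).mul ((hg.pow 2).const_sub 1)).add
    ((hg.pow 4).const_mul (a / 4))).sub ((hg.pow 2).const_mul (b / 2))
  refine this.congr_deriv ?_
  simp only [Pi.pow_apply]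
  push_cast
  ring

lemma continuousOn_ham (h : IsDampedSol a b p f g) :
    ContinuousOn (fun r => Ham a b (f r) (g r)) (Ici 0) := by
  have hf := h.cont_f
  have hg := h.cont_g
  unfold Ham
  fun_prop

lemma sq_lt_one (h : IsDampedSol a b p f g) {r : ℝ} (hr : 0 ≤ r) : g r ^ 2 < 1 := by
  have hmax : Continuous fun r : ℝ => max r 0 := by fun_prop
  have hq : Continuous fun r => 2 * (f (max r 0) * g (max r 0)) := by
    have hf := h.cont_f.comp_continuous hmax (fun r => le_max_right r 0)
    have hg := h.cont_g.comp_continuous hmax (fun r => le_max_right r 0)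
    exact continuous_const.mul (hf.mul hg)
  set q : ℝ → ℝ := fun r => 2 * (f (max r 0) * g (max r 0)) with hq_def
  have hI : ∀ r, HasDerivAt (fun r => ∫ s in (0 : ℝ)..r, q s) (q r) r := fun r =>
    intervalIntegral.integral_hasDerivAt_right (hq.intervalIntegrable _ _)
      (hq.stronglyMeasurableAtFilter _ _) hq.continuousAt
  set I : ℝ → ℝ := fun r => ∫ s in (0 : ℝ)..r, q s with hI_def
  have hle : (1 - g 0 ^ 2) * exp (I 0) ≤ (1 - g r ^ 2) * exp (I r) := by
    refine le_of_hasDerivAt_nonneg (u := fun r => (1 - g r ^ 2) * exp (I r)) (u' := fun _ => 0)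
      hr ?_ (fun s hs => ?_) (fun _ _ => le_rfl)
    · have hg := h.cont_g.mono (Icc_subset_Ici_self : Icc 0 r ⊆ Ici 0)
      have hIc : Continuous I := continuous_iff_continuousAt.2 fun r => (hI r).continuousAt
      fun_prop
    · have := (((h.deriv_g s hs.1).pow 2).const_sub 1).mul (hI s).exp
      refine this.congr_deriv ?_
      simp only [Pi.pow_apply, hq_def, max_eq_left hs.1.le]
      push_cast
      ring
  have h0 : 0 < (1 - g 0 ^ 2) * exp (I 0) := mul_pos (by linarith [h.init_g]) (exp_pos _)
  have := pos_of_mul_pos_left (h0.trans_le hle) (exp_pos _).le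
  linarith

lemma ham_anti (h : IsDampedSol a b p f g) {s t : ℝ} (hs : 0 ≤ s) (hst : s ≤ t) :
    Ham a b (f t) (g t) ≤ Ham a b (f s) (g s) := by
  have := le_of_hasDerivAt_nonneg (u := fun r => -Ham a b (f r) (g r)) hst
    (h.continuousOn_ham.mono fun r hr => hs.trans hr.1).neg
    (fun r hr => (h.hasDerivAt_ham (hs.trans_lt hr.1)).neg) (fun r hr => ?_)
  · linarith
  · have hr0 := hs.trans_lt hr.1
    have := h.p_nonneg r hr0
    have := h.sq_lt_one hr0.le
    have : 0 ≤ 1 - g r ^ 2 := by linarith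
    rw [neg_neg]
    positivity

lemma sq_le (h : IsDampedSol a b p f g) {r : ℝ} (hr : 0 ≤ r) : f r ^ 2 ≤ a - b := by
  have h1 := h.ham_anti le_rfl hr
  have h2 := h.sq_lt_one hr
  have h3 := h.init_g
  have ha := h.pos_a
  have hab := h.two_mul_lt
  simp only [Ham, h.init_f] at h1
  have h4 : (1 - g 0 ^ 2) * (a / 4 * (1 + g 0 ^ 2) - b / 2) ≥ 0 :=
    mul_nonneg (by linarith) (by nlinarith [sq_nonneg (g 0)])
  have h5 : (1 - g r ^ 2) * (f r ^ 2 / 2) ≤ (1 - g r ^ 2) * (a / 4 * (1 + g r ^ 2) - b / 2) := by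
    nlinarith
  have h6 := le_of_mul_le_mul_left h5 (by linarith)
  nlinarith

lemma abs_le (h : IsDampedSol a b p f g) {r : ℝ} (hr : 0 ≤ r) : |f r| ≤ √(a - b) :=
  Real.abs_le_sqrt (h.sq_le hr)

/-- While `f` is nonnegative, the energy lost is controlled by the increase of `g`. -/
lemma ham_sub_le_of_nonneg (h : IsDampedSol a b p f g) {R s t : ℝ} (hR : 0 < R) (hs : R ≤ s)
    (hst : s ≤ t) (hf : ∀ r ∈ Ioo s t, 0 ≤ f r) :
    Ham a b (f s) (g s) - Ham a b (f t) (g t) ≤ 4 * √(a - b) / R := by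
  have key := le_of_hasDerivAt_nonneg
    (u := fun r => Ham a b (f r) (g r) + 2 * √(a - b) / R * g r) hst
    ((h.continuousOn_ham.add (continuousOn_const.mul h.cont_g)).mono
      fun r hr => (hR.le.trans hs).trans hr.1)
    (fun r hr => (h.hasDerivAt_ham (hR.trans_le (hs.trans hr.1.le))).add
      ((h.deriv_g r (hR.trans_le (hs.trans hr.1.le))).const_mul _)) (fun r hr => ?_)
  · have hgs := abs_le_of_sq_le_sq' (a := g s) (b := 1)
      (by linarith [h.sq_lt_one (hR.le.trans hs)]) zero_le_one
    have hgt := abs_le_of_sq_le_sq' (a := g t) (b := 1)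
      (by linarith [h.sq_lt_one (hR.le.trans (hs.trans hst))]) zero_le_one
    have hK : 0 ≤ 2 * √(a - b) / R := by positivity
    have : 4 * √(a - b) / R = 2 * √(a - b) / R * 2 := by ring
    nlinarith
  · have hRr : R ≤ r := hs.trans hr.1.le
    have hr0 : 0 < r := hR.trans_le hRr
    have hp : p r ≤ 2 / R := (h.p_le r hr0).trans (by gcongr)
    have hfr := hf r hr
    have hfM : f r ≤ √(a - b) := (le_abs_self _).trans (h.abs_le hr0.le)
    have hw : 0 ≤ 1 - g r ^ 2 := by linarith [h.sq_lt_one hr0.le]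
    have hpf : p r * f r ≤ 2 / R * √(a - b) := by gcongr
    have : 0 ≤ (2 / R * √(a - b) - p r * f r) * (f r * (1 - g r ^ 2)) :=
      mul_nonneg (by linarith) (by positivity)
    calc 0 ≤ _ := this
      _ = _ := by ring

lemma ham_sub_le_of_nonpos (h : IsDampedSol a b p f g) {R s t : ℝ} (hR : 0 < R) (hs : R ≤ s)
    (hst : s ≤ t) (hf : ∀ r ∈ Ioo s t, f r ≤ 0) :
    Ham a b (f s) (g s) - Ham a b (f t) (g t) ≤ 4 * √(a - b) / R := by
  have := h.neg.ham_sub_le_of_nonneg hR hs hst fun r hr => by linarith [hf r hr]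
  simpa [ham_neg] using this

/-- At positive energy, only a bounded multiple of `1 / R` is lost while `g` is nonnegative. -/
lemma ham_sub_le_of_g_nonneg (h : IsDampedSol a b p f g) {R s t : ℝ} (hR : 0 < R) (hs : R ≤ s)
    (hst : s ≤ t) (hH : ∀ r ∈ Icc s t, 0 < Ham a b (f r) (g r)) (hg : ∀ r ∈ Icc s t, 0 ≤ g r) :
    Ham a b (f s) (g s) - Ham a b (f t) (g t) ≤ 8 * √(a - b) / R := by
  obtain ⟨z, hz, hz1, hz2⟩ := exists_sign_split hst
    (fun r hr => h.deriv_f r (hR.trans_le (hs.trans hr.1))) (fun r hr h0 => by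
      have hHr := hH r hr
      have hgr := hg r hr
      have hb := h.pos_b
      simp only [Ham, h0] at hHr
      have h1 : 0 < g r ^ 2 * (a * g r ^ 2 - 2 * b) := by nlinarith
      have h2 : 0 < a * g r ^ 2 - 2 * b := pos_of_mul_pos_right h1 (sq_nonneg _)
      have h3 : 0 < g r := by
        refine lt_of_le_of_ne hgr fun h3 => ?_
        rw [← h3] at h1
        simp at h1
      rw [h0]
      nlinarith)
  have h1 := h.ham_sub_le_of_nonneg hR hs hz.1 hz1
  have h2 := h.ham_sub_le_of_nonpos hR (hs.trans hz.1) hz.2 hz2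
  have : 8 * √(a - b) / R = 4 * √(a - b) / R + 4 * √(a - b) / R := by ring
  linarith

lemma ham_sub_le_of_g_nonpos (h : IsDampedSol a b p f g) {R s t : ℝ} (hR : 0 < R) (hs : R ≤ s)
    (hst : s ≤ t) (hH : ∀ r ∈ Icc s t, 0 < Ham a b (f r) (g r)) (hg : ∀ r ∈ Icc s t, g r ≤ 0) :
    Ham a b (f s) (g s) - Ham a b (f t) (g t) ≤ 8 * √(a - b) / R := by
  have := h.neg.ham_sub_le_of_g_nonneg hR hs hst (fun r hr => by simpa [ham_neg] using hH r hr)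
    fun r hr => by linarith [hg r hr]
  simpa [ham_neg] using this

lemma ham_sub_le_of_g_ne_zero (h : IsDampedSol a b p f g) {R s t : ℝ} (hR : 0 < R) (hs : R ≤ s)
    (hst : s ≤ t) (hH : ∀ r ∈ Icc s t, 0 < Ham a b (f r) (g r)) (hg : ∀ r ∈ Ioo s t, g r ≠ 0) :
    Ham a b (f s) (g s) - Ham a b (f t) (g t) ≤ 8 * √(a - b) / R := by
  rcases hst.eq_or_lt with rfl | hlt
  · rw [sub_self]
    positivity
  have hc : ContinuousOn g (Icc s t) := h.cont_g.mono fun r hr => (hR.le.trans hs).trans hr.1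
  have hcl : closure (Ioo s t) = Icc s t := closure_Ioo hlt.ne
  rw [← hcl] at hc
  rcases isPreconnected_Ioo.mapsTo_Ioi_or_Iio (hc.mono subset_closure) hg with hp | hn
  · refine h.ham_sub_le_of_g_nonneg hR hs hst hH fun r hr => ?_
    exact le_on_closure (fun r hr => (hp hr).le) continuousOn_const hc (hcl.symm ▸ hr)
  · refine h.ham_sub_le_of_g_nonpos hR hs hst hH fun r hr => ?_
    exact le_on_closure (fun r hr => (hn hr).le) hc continuousOn_const (hcl.symm ▸ hr)

/-- At positive energy, the energy lost is controlled by the number of zeros of `g`. -/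
lemma ham_sub_le_of_ncard (h : IsDampedSol a b p f g) {R : ℝ} (hR : 0 < R) (n : ℕ) :
    ∀ s t : ℝ, R ≤ s → s ≤ t → (∀ r ∈ Icc s t, 0 < Ham a b (f r) (g r)) →
      {r ∈ Ioo s t | g r = 0}.Finite → {r ∈ Ioo s t | g r = 0}.ncard = n →
      Ham a b (f s) (g s) - Ham a b (f t) (g t) ≤ (n + 1) * (8 * √(a - b) / R) := by
  induction n using Nat.strong_induction_on with
  | _ n ih =>
    intro s t hs hst hH hfin hcard
    by_cases hz : ∃ z ∈ Ioo s t, g z = 0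
    · obtain ⟨z, hz, hz0⟩ := hz
      have hsub1 : {r ∈ Ioo s z | g r = 0} ⊆ {r ∈ Ioo s t | g r = 0} :=
        fun r hr => ⟨⟨hr.1.1, hr.1.2.trans hz.2⟩, hr.2⟩
      have hsub2 : {r ∈ Ioo z t | g r = 0} ⊆ {r ∈ Ioo s t | g r = 0} :=
        fun r hr => ⟨⟨hz.1.trans hr.1.1, hr.1.2⟩, hr.2⟩
      have hfin1 := hfin.subset hsub1
      have hfin2 := hfin.subset hsub2
      have hdisj : Disjoint {r ∈ Ioo s z | g r = 0} {r ∈ Ioo z t | g r = 0} :=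
        Set.disjoint_left.2 fun r h1 h2 => lt_asymm h1.1.2 h2.1.1
      have hlt : {r ∈ Ioo s z | g r = 0}.ncard + {r ∈ Ioo z t | g r = 0}.ncard < n := by
        rw [← hcard, ← ncard_union_eq hdisj hfin1 hfin2]
        refine ncard_lt_ncard ((ssubset_iff_of_subset (union_subset hsub1 hsub2)).2
          ⟨z, ⟨hz, hz0⟩, ?_⟩) hfin
        rintro (h1 | h1)
        · exact lt_irrefl _ h1.1.2
        · exact lt_irrefl _ h1.1.1
      have i1 := ih _ (by omega) s z hs hz.1.le
        (fun r hr => hH r ⟨hr.1, hr.2.trans hz.2.le⟩) hfin1 rfl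
      have i2 := ih _ (by omega) z t (hs.trans hz.1.le) hz.2.le
        (fun r hr => hH r ⟨hz.1.le.trans hr.1, hr.2⟩) hfin2 rfl
      have hlt' : (({r ∈ Ioo s z | g r = 0}.ncard : ℝ) + 1) + ({r ∈ Ioo z t | g r = 0}.ncard + 1)
          ≤ n + 1 := by
        exact_mod_cast (by omega)
      have hK : 0 ≤ 8 * √(a - b) / R := by positivity
      nlinarith [mul_le_mul_of_nonneg_right hlt' hK]
    · push Not at hz
      have hK : 0 ≤ 8 * √(a - b) / R := by positivity
      have := h.ham_sub_le_of_g_ne_zero hR hs hst hH hz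
      nlinarith [mul_nonneg n.cast_nonneg hK]

lemma one_sub_sq_le (h : IsDampedSol a b p f g) {r : ℝ} (hr : 0 ≤ r) :
    1 - g r ^ 2 ≤ (1 - g 0 ^ 2) * exp (2 * √(a - b) * r) := by
  have := le_of_hasDerivAt_nonneg (u := fun s => -((1 - g s ^ 2) * exp (-(2 * √(a - b)) * s))) hr
    ?_ (fun s hs => ((((h.deriv_g s hs.1).pow 2).const_sub 1).mul
      ((hasDerivAt_id s).const_mul (-(2 * √(a - b)))).exp).neg) (fun s hs => ?_)
  · simp only [mul_zero, exp_zero, mul_one, neg_le_neg_iff] at this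
    have h2 := mul_le_mul_of_nonneg_right this (exp_pos (2 * √(a - b) * r)).le
    rwa [mul_assoc, ← exp_add, neg_mul, neg_add_cancel, exp_zero, mul_one] at h2
  · have hg := h.cont_g.mono (Icc_subset_Ici_self : Icc 0 r ⊆ Ici 0)
    fun_prop
  · have hw : 0 ≤ 1 - g s ^ 2 := by linarith [h.sq_lt_one hs.1.le]
    have hg : |g s| ≤ 1 := (sq_le_one_iff_abs_le_one _).1 (h.sq_lt_one hs.1.le).le
    have hfg : -(f s * g s) ≤ √(a - b) := by
      calc -(f s * g s) ≤ |f s * g s| := neg_le_abs _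
        _ = |f s| * |g s| := abs_mul _ _
        _ ≤ √(a - b) * 1 := mul_le_mul (h.abs_le hs.1.le) hg (abs_nonneg _) (sqrt_nonneg _)
        _ = √(a - b) := mul_one _
    have : 0 ≤ 2 * (√(a - b) + f s * g s) * (1 - g s ^ 2) * exp (-(2 * √(a - b)) * s) :=
      mul_nonneg (mul_nonneg (by linarith) hw) (exp_pos _).le
    calc 0 ≤ _ := this
      _ = _ := by
        simp only [Pi.pow_apply, id]
        push_cast
        ring

/-- The energy lost up to time `R` is small when `g` starts close to `1`. -/
lemma ham_ge (h : IsDampedSol a b p f g) {R : ℝ} (hR : 0 ≤ R) :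
    (a - 2 * b) / 4 - (1 - g 0 ^ 2) *
      (a / 2 + exp (2 * √(a - b) * R) * (2 * a * √(a - b)) * R) ≤ Ham a b (f R) (g R) := by
  have ha := h.pos_a
  have hb := h.pos_b
  have hab := h.two_mul_lt
  set M := √(a - b) with hM
  set δ := (1 - g 0 ^ 2) * exp (2 * M * R) with hδ
  have hw0 : 0 < 1 - g 0 ^ 2 := by linarith [h.init_g]
  have hδ0 : 0 < δ := mul_pos hw0 (exp_pos _)
  have key := le_of_hasDerivAt_nonneg
    (u := fun r => Ham a b (f r) (g r) - δ / 2 * f r ^ 2 + δ * (2 * a * M) * r) hR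
    ?_ (fun s hs => ((h.hasDerivAt_ham hs.1).sub
      (((h.deriv_f s hs.1).pow 2).const_mul (δ / 2))).add
        ((hasDerivAt_id s).const_mul (δ * (2 * a * M)))) (fun s hs => ?_)
  · have h1 : Ham a b (f 0) (g 0) ≥ (a - 2 * b) / 4 - (1 - g 0 ^ 2) * (a / 2) := by
      simp only [Ham, h.init_f]
      nlinarith [sq_nonneg (g 0), mul_nonneg hw0.le (sq_nonneg (g 0)), mul_pos hw0 ha,
        mul_pos hw0 hb, h.init_g, mul_pos (mul_pos hw0 hw0) ha]
    simp only [h.init_f] at key h1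
    have h2 : 0 ≤ δ / 2 * f R ^ 2 := by positivity
    simp only [hδ] at key h2
    linarith
  · have h1 := h.continuousOn_ham.mono (Icc_subset_Ici_self : Icc 0 R ⊆ Ici 0)
    have h2 := h.cont_f.mono (Icc_subset_Ici_self : Icc 0 R ⊆ Ici 0)
    fun_prop
  · have hwδ : 1 - g s ^ 2 ≤ δ := (h.one_sub_sq_le hs.1.le).trans (by
      rw [hδ]
      have := hs.2.le
      gcongr)
    have hg2 := h.sq_lt_one hs.1.le
    have hg : |g s| ≤ 1 := (sq_le_one_iff_abs_le_one _).1 hg2.le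
    have hf2 := h.sq_le hs.1.le
    have hP : |f s ^ 2 - a * g s ^ 2 + b| ≤ 2 * a := by
      rw [_root_.abs_le]
      constructor <;> nlinarith [sq_nonneg (f s), sq_nonneg (g s)]
    have hfgP : f s * g s * (f s ^ 2 - a * g s ^ 2 + b) ≤ 2 * a * M := by
      calc _ ≤ |f s * g s * (f s ^ 2 - a * g s ^ 2 + b)| := le_abs_self _
        _ = |f s| * |g s| * |f s ^ 2 - a * g s ^ 2 + b| := by rw [abs_mul, abs_mul]
        _ ≤ M * 1 * (2 * a) := by
          have := h.abs_le hs.1.le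
          gcongr
        _ = 2 * a * M := by ring
    have t1 : 0 ≤ p s * f s ^ 2 * (δ - (1 - g s ^ 2)) :=
      mul_nonneg (mul_nonneg (h.p_nonneg s hs.1) (sq_nonneg _)) (by linarith)
    have t2 : 0 ≤ δ * (2 * a * M - f s * g s * (f s ^ 2 - a * g s ^ 2 + b)) :=
      mul_nonneg hδ0.le (by linarith)
    calc 0 ≤ _ := add_nonneg t1 t2
      _ = _ := by
        push_cast
        ring

/-- If the energy has a nonpositive limit and `g` changes sign exactly `k` times, then the energy
at time `R` exceeds any positive level by at most a multiple of `(k + 1) / R`. -/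
lemma ham_le_of_changesSignExactly (h : IsDampedSol a b p f g) {R c L : ℝ} {k : ℕ} (hR : 0 < R)
    (hc : 0 < c) (hL : L ≤ 0) (hlim : Tendsto (fun r => Ham a b (f r) (g r)) atTop (𝓝 L))
    (hk : ChangesSignExactly g (Ioi 0) k) :
    Ham a b (f R) (g R) ≤ c + (k + 1) * (8 * √(a - b) / R) := by
  have hK : 0 ≤ 8 * √(a - b) / R := by positivity
  by_contra! hcon
  have hcR : c ≤ Ham a b (f R) (g R) := by nlinarith [k.cast_nonneg (α := ℝ)]
  obtain ⟨T', hT'c, hRT'⟩ :=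
    ((hlim.eventually (gt_mem_nhds (hL.trans_lt hc))).and (eventually_ge_atTop R)).exists
  obtain ⟨T, hT, hTc⟩ := intermediate_value_Icc' hRT'
    (h.continuousOn_ham.mono fun r hr => hR.le.trans hr.1) ⟨hT'c.le, hcR⟩
  have hpos : ∀ r ∈ Icc R T, 0 < Ham a b (f r) (g r) := fun r hr =>
    hc.trans_le (hTc.symm.le.trans (h.ham_anti (hR.le.trans hr.1) hr.2))
  have hsub : {r ∈ Ioo R T | g r = 0} ⊆ {r | ChangesSignAt g (Ioi 0) r} := by
    rintro r ⟨hr, hr0⟩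
    have hrpos := hR.trans hr.1
    refine .of_hasDerivAt hrpos (h.deriv_g r hrpos) hr0 fun h0 => ?_
    have hHr := hpos r (Ioo_subset_Icc_self hr)
    simp only [hr0] at h0
    have hf0 : f r = 0 := by linarith
    simp [Ham, hr0, hf0] at hHr
  have hn : {r ∈ Ioo R T | g r = 0}.ncard ≤ k := hk.2 ▸ ncard_le_ncard hsub hk.1
  have := h.ham_sub_le_of_ncard hR _ R T le_rfl hT.1 hpos (hk.1.subset hsub) rfl
  have hn' : ({r ∈ Ioo R T | g r = 0}.ncard : ℝ) + 1 ≤ k + 1 := by exact_mod_cast (by omega)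
  have hmul := mul_le_mul_of_nonneg_right hn' hK
  simp only at hTc
  linarith

end IsDampedSol

lemma IsRegSolOn.isDampedSol {a b η x : ℝ} {φ : ℝ → ℝ → ℝ} {f g : ℝ → ℝ} (hb : 0 < b)
    (hab : 2 * b < a) (hφ : IsCutoff a b η φ) (hx : x ∈ Ioo (0 : ℝ) 1)
    (h : IsRegSolOn a b φ x f g (Ici 0)) :
    IsDampedSol a b (fun r => 2 * φ (f r) (g r) / r) f g where
  pos_a := by linarith
  pos_b := hb
  two_mul_lt := hab
  init_f := h.1
  init_g := by
    rw [h.2.1]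
    nlinarith [hx.1, hx.2]
  cont_f := h.2.2.1
  cont_g := h.2.2.2.1
  p_nonneg r hr := by
    have := (hφ.1 (f r) (g r)).1
    positivity
  p_le r hr := by
    have := (hφ.1 (f r) (g r)).2
    gcongr
    linarith
  deriv_f r hr := (h.2.2.2.2 r hr.le hr).1
  deriv_g r hr := (h.2.2.2.2 r hr.le hr).2

/-- Lemma 2.8 (ii): `A_k ∪ I_k` is bounded away from `1`. -/
theorem AkIk_bounded_away (a b η : ℝ) (hb : 0 < b) (hab : 2 * b < a)
    (hη : η ∈ Ioo 0 (Real.sqrt (a - b) - Real.sqrt (a / 2)))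
    (φ : ℝ → ℝ → ℝ) (hφ : IsCutoff a b η φ)
    (F G : ℝ → ℝ → ℝ)
    (hFG : ∀ y ∈ Ioo (0 : ℝ) 1, IsRegSolOn a b φ y (F y) (G y) (Ici 0))
    (k : ℕ) :
    ∃ ε ∈ Ioo (0 : ℝ) 1, Aset a b F G k ∪ Iset a b F G k ⊆ Ioo 0 (1 - ε) := by
  have ha : 0 < a := by linarith
  set E := (a - 2 * b) / 4 with hE
  have hE0 : 0 < E := by
    rw [hE]
    linarith
  obtain ⟨R, hR, hRE⟩ : ∃ R, 0 < R ∧ (k + 1) * (8 * √(a - b) / R) < E / 4 := by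
    refine ⟨(k + 1) * (8 * √(a - b)) / (E / 8) + 1, by positivity, ?_⟩
    rw [← mul_div_assoc, div_lt_iff₀ (by positivity)]
    have : E / 4 * ((k + 1) * (8 * √(a - b)) / (E / 8) + 1)
        = 2 * ((k + 1) * (8 * √(a - b))) + E / 4 := by
      field_simp
      ring
    rw [this]
    have : 0 ≤ (k + 1) * (8 * √(a - b)) := by positivity
    linarith
  set D := a / 2 + exp (2 * √(a - b) * R) * (2 * a * √(a - b)) * R with hD
  have hD0 : 0 < D := by positivity
  have hε0 : 0 < min (1 / 2) (E / (8 * D)) := by positivity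
  refine ⟨min (1 / 2) (E / (8 * D)), ⟨hε0, (min_le_left _ _).trans_lt (by norm_num)⟩, ?_⟩
  have main : ∀ x ∈ Ioo (0 : ℝ) 1, ∀ L ≤ 0,
      Tendsto (fun r => Ham a b (F x r) (G x r)) atTop (𝓝 L) →
      ChangesSignExactly (G x) (Ioi 0) k → x ∈ Ioo 0 (1 - min (1 / 2) (E / (8 * D))) := by
    intro x hx L hL hlim hk
    refine ⟨hx.1, ?_⟩
    by_contra! hxε
    have hsol := (hFG x hx).isDampedSol hb hab hφ hx
    have h1 := hsol.ham_ge hR.le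
    have h2 := hsol.ham_le_of_changesSignExactly hR (half_pos hE0) hL hlim hk
    rw [(hFG x hx).2.1, ← hD, ← hE] at h1
    have h3 : 1 - x ^ 2 ≤ 2 * (E / (8 * D)) := by
      nlinarith [hx.1, hx.2, min_le_right (1 / 2) (E / (8 * D))]
    have h4 : (1 - x ^ 2) * D ≤ E / 4 := by
      calc _ ≤ 2 * (E / (8 * D)) * D := by gcongr
        _ = E / 4 := by
          field_simp
          ring
    linarith
  rintro x (⟨hx, ⟨L, hL, hlim⟩, hk⟩ | ⟨hx, hlim, hk⟩)
  · exact main x hx L hL.le hlim hk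
  · refine main x hx 0 le_rfl ?_ hk
    have hcont : Continuous fun q : ℝ × ℝ => Ham a b q.1 q.2 := by
      unfold Ham
      fun_prop
    simpa [Ham, Function.comp_def] using (hcont.tendsto ((0 : ℝ), (0 : ℝ))).comp hlim
end
end

section
/- Let a, b > 0 with a − 2b > 0, η ∈ (0, √(a−b) − √(a/2)), φ_η an admissible cutoff, and k ∈ ℕ. If x ∈ I_k, then there exists ε > 0 such that (x − ε, x + ε) ⊂ A_k ∪ I_k ∪ A_{k+1}. -/
open Real Set Filter Topology

noncomputable section

/-! ### Calculus on intervals -/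

lemma le_of_hasDerivAt_nonpos {u u' : ℝ → ℝ} {s t : ℝ} (hst : s ≤ t)
    (hc : ContinuousOn u (Icc s t)) (hd : ∀ r ∈ Ioo s t, HasDerivAt u (u' r) r)
    (hn : ∀ r ∈ Ioo s t, u' r ≤ 0) : u t ≤ u s := by
  have := antitoneOn_of_hasDerivWithinAt_nonpos (convex_Icc s t) hc (f' := u')
    (by rw [interior_Icc]; exact fun r hr => (hd r hr).hasDerivWithinAt)
    (by rw [interior_Icc]; exact hn)
  exact this (left_mem_Icc.2 hst) (right_mem_Icc.2 hst) hst

lemma lt_of_hasDerivAt_pos {u u' : ℝ → ℝ} {s t : ℝ} (hst : s < t)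
    (hc : ContinuousOn u (Icc s t)) (hd : ∀ r ∈ Ioo s t, HasDerivAt u (u' r) r)
    (hn : ∀ r ∈ Ioo s t, 0 < u' r) : u s < u t := by
  have := strictMonoOn_of_hasDerivWithinAt_pos (convex_Icc s t) hc (f' := u')
    (by rw [interior_Icc]; exact fun r hr => (hd r hr).hasDerivWithinAt)
    (by rw [interior_Icc]; exact hn)
  exact this (left_mem_Icc.2 hst.le) (right_mem_Icc.2 hst.le) hst

/-- A continuous function that is positive at `s` and nonpositive at `t` has a first zero. -/
lemma exists_first_zero {h : ℝ → ℝ} {s t : ℝ} (hst : s ≤ t) (hc : ContinuousOn h (Icc s t))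
    (hs : 0 < h s) (ht : h t ≤ 0) :
    ∃ z ∈ Ioc s t, h z = 0 ∧ ∀ r ∈ Ico s z, 0 < h r := by
  have hcl : IsClosed (Icc s t ∩ h ⁻¹' Iic 0) := hc.preimage_isClosed_of_isClosed isClosed_Icc
    isClosed_Iic
  have hne : (Icc s t ∩ h ⁻¹' Iic 0).Nonempty := ⟨t, right_mem_Icc.2 hst, ht⟩
  have hbd : BddBelow (Icc s t ∩ h ⁻¹' Iic 0) := ⟨s, fun r hr => hr.1.1⟩
  obtain ⟨⟨hz1, hz2⟩, hz3⟩ := hcl.csInf_mem hne hbd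
  set z := sInf (Icc s t ∩ h ⁻¹' Iic 0) with hz
  have hpos : ∀ r ∈ Ico s z, 0 < h r := by
    intro r hr
    by_contra hneg
    have : z ≤ r := csInf_le hbd ⟨⟨hr.1, hr.2.le.trans hz2⟩, not_lt.1 hneg⟩
    exact absurd hr.2 (not_lt.2 this)
  have hsz : s < z := by
    rcases hz1.lt_or_eq with h1 | h1
    · exact h1
    · rw [← h1] at hz3
      exact absurd hs (not_lt.2 hz3)
  refine ⟨z, ⟨hsz, hz2⟩, ?_, hpos⟩
  obtain ⟨w, hw, hw0⟩ := intermediate_value_Icc' hz1 (hc.mono (Icc_subset_Icc_right hz2))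
    ⟨hz3, hs.le⟩
  rcases hw.2.lt_or_eq with h1 | h1
  · exact absurd hw0 (hpos w ⟨hw.1, h1⟩).ne'
  · rwa [h1] at hw0

/-- A continuous function without zeros on an interval keeps its sign. -/
lemma pos_of_forall_ne_zero {h : ℝ → ℝ} {s t : ℝ} (hst : s ≤ t) (hc : ContinuousOn h (Icc s t))
    (hs : 0 < h s) (hne : ∀ r ∈ Icc s t, h r ≠ 0) : 0 < h t := by
  by_contra hneg
  obtain ⟨z, hz, hz0, -⟩ := exists_first_zero hst hc hs (not_lt.1 hneg)
  exact hne z ⟨hz.1.le, hz.2⟩ hz0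

/-! ### Algebra of the Hamiltonian -/

lemma Ham_neg (a b p q : ℝ) : Ham a b (-p) (-q) = Ham a b p q := by
  unfold Ham; ring

lemma sq_le_of_small {a b p q : ℝ} (hb : 0 < b) (hab : 2 * b < a) (hq : q ^ 2 ≤ b / (2 * a))
    (hH : Ham a b p q ≤ a / 8) : p ^ 2 ≤ a / 2 := by
  have ha : 0 < a := by linarith
  have h1 : q ^ 2 * (2 * a) ≤ b := by rwa [le_div_iff₀ (by positivity)] at hq
  unfold Ham at hH
  have h4 : q ^ 2 ≤ 1 / 4 := by nlinarith
  have h5 : b * q ^ 2 ≤ a / 8 := by nlinarith [sq_nonneg q]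
  nlinarith [sq_nonneg p, sq_nonneg q, sq_nonneg (q ^ 2), mul_nonneg ha.le (sq_nonneg (q ^ 2))]

lemma Ham_le_of_small {a b p q : ℝ} (hb : 0 < b) (hab : 2 * b < a) (hq : q ^ 2 ≤ b / (2 * a)) :
    Ham a b p q ≤ 1 / 2 * (p ^ 2 * (1 - q ^ 2)) := by
  have ha : 0 < a := by linarith
  have h1 : q ^ 2 * (2 * a) ≤ b := by rwa [le_div_iff₀ (by positivity)] at hq
  unfold Ham
  nlinarith [sq_nonneg q]

lemma le_sq_of_Ham_nonneg {a b p q : ℝ} (hb : 0 < b) (hab : 2 * b < a)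
    (hq : q ^ 2 ≤ b / (2 * a)) (hH : 0 ≤ Ham a b p q) :
    b / 2 * q ^ 2 ≤ p ^ 2 * (1 - q ^ 2) := by
  have ha : 0 < a := by linarith
  have h1 : q ^ 2 * (2 * a) ≤ b := by rwa [le_div_iff₀ (by positivity)] at hq
  unfold Ham at hH
  nlinarith [sq_nonneg q]

lemma le_sq_of_Ham_nonneg' {a b p q : ℝ} (hb : 0 < b) (hab : 2 * b < a)
    (hq : q ^ 2 ≤ b / (2 * a)) (hH : 0 ≤ Ham a b p q) :
    b / 2 * q ^ 2 ≤ p ^ 2 := by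
  have := le_sq_of_Ham_nonneg hb hab hq hH
  nlinarith [mul_nonneg (sq_nonneg p) (sq_nonneg q)]

lemma Ham_lower_bound {a b p q : ℝ} (ha : 0 < a) (hb : 0 < b) (hq : q ^ 2 ≤ 1) :
    -(b / 2) ≤ Ham a b p q := by
  unfold Ham
  nlinarith [mul_nonneg (sq_nonneg p) (sub_nonneg.2 hq), mul_nonneg ha.le (sq_nonneg (q ^ 2))]

lemma Ham_zero_right_nonneg (a b p : ℝ) : 0 ≤ Ham a b p 0 := by
  unfold Ham; nlinarith [sq_nonneg p]

lemma continuous_Ham (a b : ℝ) : Continuous (fun p : ℝ × ℝ => Ham a b p.1 p.2) := by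
  unfold Ham; fun_prop

/-! ### Damped solutions away from the origin -/

/-- `(f, g)` solves the Hamiltonian system with friction `2 ψ(r) / r` on `[R, ∞)`, where the
friction is nonnegative, and not cut off as long as `f ^ 2 ≤ a / 2`. -/
structure DampedSol (a b R : ℝ) (ψ f g : ℝ → ℝ) : Prop where
  pos : 0 < R
  deriv_f : ∀ r, R ≤ r →
    HasDerivAt f (g r * ((f r) ^ 2 - a * (g r) ^ 2 + b) - 2 * ψ r / r * f r) r
  deriv_g : ∀ r, R ≤ r → HasDerivAt g (f r * (1 - (g r) ^ 2)) r
  nonneg : ∀ r, R ≤ r → 0 ≤ ψ r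
  eq_one : ∀ r, R ≤ r → (f r) ^ 2 ≤ a / 2 → ψ r = 1
  lt_one : ∀ r, R ≤ r → (g r) ^ 2 < 1

namespace DampedSol

variable {a b R : ℝ} {ψ f g : ℝ → ℝ}

lemma neg (h : DampedSol a b R ψ f g) : DampedSol a b R ψ (fun r => -f r) (fun r => -g r) where
  pos := h.pos
  deriv_f r hr := by
    refine (h.deriv_f r hr).neg.congr_deriv ?_
    ring
  deriv_g r hr := by
    refine (h.deriv_g r hr).neg.congr_deriv ?_
    ring
  nonneg := h.nonneg
  eq_one r hr := by simpa using h.eq_one r hr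
  lt_one r hr := by simpa using h.lt_one r hr

lemma mono (h : DampedSol a b R ψ f g) {S : ℝ} (hS : R ≤ S) : DampedSol a b S ψ f g where
  pos := h.pos.trans_le hS
  deriv_f r hr := h.deriv_f r (hS.trans hr)
  deriv_g r hr := h.deriv_g r (hS.trans hr)
  nonneg r hr := h.nonneg r (hS.trans hr)
  eq_one r hr := h.eq_one r (hS.trans hr)
  lt_one r hr := h.lt_one r (hS.trans hr)

lemma contOn_f (h : DampedSol a b R ψ f g) {s t : ℝ} (hs : R ≤ s) : ContinuousOn f (Icc s t) :=
  fun r hr => (h.deriv_f r (hs.trans hr.1)).continuousAt.continuousWithinAt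

lemma contOn_g (h : DampedSol a b R ψ f g) {s t : ℝ} (hs : R ≤ s) : ContinuousOn g (Icc s t) :=
  fun r hr => (h.deriv_g r (hs.trans hr.1)).continuousAt.continuousWithinAt

lemma hasDerivAt_Ham (h : DampedSol a b R ψ f g) {r : ℝ} (hr : R ≤ r) :
    HasDerivAt (fun r => Ham a b (f r) (g r))
      (-(2 * ψ r / r * ((f r) ^ 2 * (1 - (g r) ^ 2)))) r := by
  have hf := h.deriv_f r hr
  have hg := h.deriv_g r hr
  have := ((((hf.pow 2).const_mul (1 / 2)).mul ((hg.pow 2).const_sub 1)).add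
    ((hg.pow 4).const_mul (a / 4))).sub ((hg.pow 2).const_mul (b / 2))
  refine this.congr_deriv ?_
  simp only [Pi.pow_apply]
  push_cast
  ring

lemma Ham_antitone (h : DampedSol a b R ψ f g) {s t : ℝ} (hs : R ≤ s) (hst : s ≤ t) :
    Ham a b (f t) (g t) ≤ Ham a b (f s) (g s) := by
  refine le_of_hasDerivAt_nonpos (u := fun r => Ham a b (f r) (g r)) hst
    (fun r hr => (h.hasDerivAt_Ham (hs.trans hr.1)).continuousAt.continuousWithinAt)
    (fun r hr => h.hasDerivAt_Ham (hs.trans hr.1.le)) (fun r hr => ?_)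
  have hr' := hs.trans hr.1.le
  have h1 := h.nonneg r hr'
  have h2 := h.lt_one r hr'
  have h3 := h.pos.trans_le hr'
  have h4 : 0 ≤ 1 - g r ^ 2 := by linarith
  have : 0 ≤ 2 * ψ r / r * ((f r) ^ 2 * (1 - (g r) ^ 2)) := by positivity
  linarith

lemma tendsto_Ham (h : DampedSol a b R ψ f g) (ha : 0 < a) (hb : 0 < b) :
    ∃ L, Tendsto (fun r => Ham a b (f r) (g r)) atTop (𝓝 L) ∧
      ∀ r, R ≤ r → L ≤ Ham a b (f r) (g r) := by
  have hanti : Antitone (fun r => Ham a b (f (max r R)) (g (max r R))) := fun s t hst =>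
    h.Ham_antitone (le_max_right _ _) (max_le_max_right _ hst)
  have hbdd : BddBelow (range fun r => Ham a b (f (max r R)) (g (max r R))) := by
    refine ⟨-(b / 2), ?_⟩
    rintro _ ⟨r, rfl⟩
    exact Ham_lower_bound ha hb (h.lt_one _ (le_max_right _ _)).le
  have hlim := tendsto_atTop_ciInf hanti hbdd
  refine ⟨_, hlim.congr' ?_, fun r hr => ?_⟩
  · filter_upwards [eventually_ge_atTop R] with r hr
    rw [max_eq_left hr]
  · have := ciInf_le hbdd r
    simpa only [max_eq_left hr] using this

lemma tendsto_Ham_neg (h : DampedSol a b R ψ f g) (ha : 0 < a) (hb : 0 < b) {t : ℝ}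
    (ht : R ≤ t) (hneg : Ham a b (f t) (g t) < 0) :
    ∃ L, L < 0 ∧ Tendsto (fun r => Ham a b (f r) (g r)) atTop (𝓝 L) := by
  obtain ⟨L, hL, hle⟩ := h.tendsto_Ham ha hb
  exact ⟨L, (hle t ht).trans_lt hneg, hL⟩

lemma ne_zero_of_Ham_neg (h : DampedSol a b R ψ f g) {t r : ℝ} (ht : R ≤ t)
    (hneg : Ham a b (f t) (g t) < 0) (hr : t ≤ r) : g r ≠ 0 := by
  intro h0
  have h1 := h.Ham_antitone ht hr
  have h2 := Ham_zero_right_nonneg a b (f r)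
  rw [h0] at h1
  linarith

lemma hasDerivAt_mul_Ham (h : DampedSol a b R ψ f g) {r : ℝ} (hr : R ≤ r)
    (hf : (f r) ^ 2 ≤ a / 2) :
    HasDerivAt (fun r => r * Ham a b (f r) (g r))
      (Ham a b (f r) (g r) - 2 * ((f r) ^ 2 * (1 - (g r) ^ 2))) r := by
  have h0 : r ≠ 0 := (h.pos.trans_le hr).ne'
  refine ((hasDerivAt_id r).mul (h.hasDerivAt_Ham hr)).congr_deriv ?_
  rw [h.eq_one r hr hf]
  simp only [id]
  field_simp
  ring

lemma mul_Ham_antitone (h : DampedSol a b R ψ f g) (hb : 0 < b) (hab : 2 * b < a) {s t : ℝ}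
    (hs : R ≤ s) (hst : s ≤ t) (hg : ∀ r ∈ Icc s t, (g r) ^ 2 ≤ b / (2 * a))
    (hH : Ham a b (f s) (g s) ≤ a / 8) :
    t * Ham a b (f t) (g t) ≤ s * Ham a b (f s) (g s) := by
  have hfr : ∀ r ∈ Icc s t, (f r) ^ 2 ≤ a / 2 := fun r hr =>
    sq_le_of_small hb hab (hg r hr) ((h.Ham_antitone hs hr.1).trans hH)
  refine le_of_hasDerivAt_nonpos (u := fun r => r * Ham a b (f r) (g r)) hst
    (fun r hr => (h.hasDerivAt_mul_Ham (hs.trans hr.1) (hfr r hr)).continuousAt.continuousWithinAt)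
    (fun r hr => h.hasDerivAt_mul_Ham (hs.trans hr.1.le) (hfr r (Ioo_subset_Icc_self hr)))
    (fun r hr => ?_)
  have hr' := Ioo_subset_Icc_self hr
  have h1 := Ham_le_of_small (p := f r) hb hab (hg r hr')
  have h2 : 0 ≤ 1 - g r ^ 2 := by linarith [h.lt_one r (hs.trans hr'.1)]
  have h3 : 0 ≤ f r ^ 2 * (1 - g r ^ 2) := by positivity
  linarith

lemma sq_mul_Ham_antitone (h : DampedSol a b R ψ f g) (hb : 0 < b) (hab : 2 * b < a) {s t : ℝ}
    (hs : R ≤ s) (hst : s ≤ t) (hg : ∀ r ∈ Icc s t, (g r) ^ 2 ≤ b / (2 * a))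
    (hH : Ham a b (f s) (g s) ≤ a / 8) (hH0 : ∀ r ∈ Icc s t, 0 ≤ Ham a b (f r) (g r)) :
    t ^ 2 * Ham a b (f t) (g t) ≤ s ^ 2 * Ham a b (f s) (g s) := by
  have hd : ∀ r ∈ Icc s t, HasDerivAt (fun r => r * (r * Ham a b (f r) (g r)))
      (r * Ham a b (f r) (g r)
        + r * (Ham a b (f r) (g r) - 2 * ((f r) ^ 2 * (1 - (g r) ^ 2)))) r := fun r hr => by
    have := h.hasDerivAt_mul_Ham (hs.trans hr.1)
      (sq_le_of_small hb hab (hg r hr) ((h.Ham_antitone hs hr.1).trans hH))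
    exact ((hasDerivAt_id r).mul this).congr_deriv (by simp)
  have := le_of_hasDerivAt_nonpos (u := fun r => r * (r * Ham a b (f r) (g r))) hst
    (fun r hr => (hd r hr).continuousAt.continuousWithinAt)
    (fun r hr => hd r (Ioo_subset_Icc_self hr)) (fun r hr => by
      have hr' := Ioo_subset_Icc_self hr
      have h1 := Ham_le_of_small (p := f r) hb hab (hg r hr')
      have h2 := h.pos.trans_le (hs.trans hr'.1)
      have h3 := hH0 r hr'
      rw [← mul_add]
      exact mul_nonpos_of_nonneg_of_nonpos h2.le (by linarith))
  calc _ = t * (t * Ham a b (f t) (g t)) := by ring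
    _ ≤ s * (s * Ham a b (f s) (g s)) := this
    _ = _ := by ring

/-- While the solution climbs along the unstable direction, the growth of `g` is paid for by
the energy. -/
lemma mul_Ham_add_sq_antitone (h : DampedSol a b R ψ f g) (hb : 0 < b) (hab : 2 * b < a)
    {s t : ℝ} (hs : R ≤ s) (hst : s ≤ t) (hg : ∀ r ∈ Icc s t, (g r) ^ 2 ≤ b / (2 * a))
    (hH : Ham a b (f s) (g s) ≤ a / 8) (hH0 : ∀ r ∈ Icc s t, 0 ≤ Ham a b (f r) (g r))
    (hf : ∀ r ∈ Ioo s t, 0 ≤ f r) :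
    t * Ham a b (f t) (g t) + √b / 2 * (g t) ^ 2
      ≤ s * Ham a b (f s) (g s) + √b / 2 * (g s) ^ 2 := by
  have hd : ∀ r ∈ Icc s t, HasDerivAt
      (fun r => r * Ham a b (f r) (g r) + √b / 2 * (g r) ^ 2)
      (Ham a b (f r) (g r) - 2 * ((f r) ^ 2 * (1 - (g r) ^ 2))
        + √b / 2 * (2 * g r * (f r * (1 - (g r) ^ 2)))) r := fun r hr => by
    have h1 := h.hasDerivAt_mul_Ham (hs.trans hr.1)
      (sq_le_of_small hb hab (hg r hr) ((h.Ham_antitone hs hr.1).trans hH))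
    refine (h1.add (((h.deriv_g r (hs.trans hr.1)).pow 2).const_mul (√b / 2))).congr_deriv ?_
    push_cast
    ring
  refine le_of_hasDerivAt_nonpos
    (u := fun r => r * Ham a b (f r) (g r) + √b / 2 * (g r) ^ 2) hst
    (fun r hr => (hd r hr).continuousAt.continuousWithinAt)
    (fun r hr => hd r (Ioo_subset_Icc_self hr)) (fun r hr => ?_)
  have hr' := Ioo_subset_Icc_self hr
  have h1 := Ham_le_of_small (p := f r) hb hab (hg r hr')
  have h2 := le_sq_of_Ham_nonneg' hb hab (hg r hr') (hH0 r hr')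
  have h3 : 0 ≤ 1 - g r ^ 2 := by linarith [h.lt_one r (hs.trans hr'.1)]
  have h4 := hf r hr
  have h5 : √b * g r ≤ 3 / 2 * f r := by
    refine le_of_abs_le (abs_le_of_sq_le_sq ?_ (by positivity))
    rw [mul_pow, Real.sq_sqrt hb.le]
    nlinarith [sq_nonneg (f r)]
  have h6 : 0 ≤ f r * (1 - g r ^ 2) := by positivity
  nlinarith [mul_nonneg h6 (sub_nonneg.2 h5)]

end DampedSol

/-- A simple zero is a strict change of sign. -/
lemma sign_near_simple_zero {g : ℝ → ℝ} {p z : ℝ} (hd : HasDerivAt g p z) (hp : 0 < p)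
    (hz : g z = 0) :
    ∃ d > 0, (∀ r, z < r → r ≤ z + d → 0 < g r) ∧ ∀ r, z - d ≤ r → r < z → g r < 0 := by
  have h1 := (hasDerivAt_iff_tendsto_slope.1 hd).eventually (eventually_gt_nhds hp)
  rw [eventually_nhdsWithin_iff, Metric.eventually_nhds_iff] at h1
  obtain ⟨e, he, h2⟩ := h1
  have h3 : ∀ r, |r - z| < e → r ≠ z → 0 < g r / (r - z) := fun r hr hne => by
    have := h2 (y := r) (by rwa [Real.dist_eq]) hne
    rwa [slope_def_field, hz, sub_zero] at this
  refine ⟨e / 2, by positivity, fun r hr hr' => ?_, fun r hr hr' => ?_⟩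
  · have := h3 r (by rw [abs_lt]; constructor <;> linarith) hr.ne'
    exact (div_pos_iff_of_pos_right (by linarith)).1 this
  · have := h3 r (by rw [abs_lt]; constructor <;> linarith) hr'.ne
    rcases div_pos_iff.1 this with h4 | h4
    · linarith [h4.2]
    · exact h4.1

namespace DampedSol

variable {a b R : ℝ} {ψ f g : ℝ → ℝ}

/-- A solution that starts on the axis `g = 0` with little energy falls into a well before `g`
vanishes again. -/
lemma exists_Ham_neg_of_pos (h : DampedSol a b R ψ f g) (hb : 0 < b) (hab : 2 * b < a)
    (hg : g R = 0) (hf : 0 < f R) (hH : Ham a b (f R) (g R) ≤ a / 8)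
    (hRH : R * Ham a b (f R) (g R) < √b / 2 * (b / (2 * a))) :
    ∃ t > R, Ham a b (f t) (g t) < 0 ∧ ∀ r ∈ Ioc R t, g r ≠ 0 := by
  have ha : 0 < a := by linarith
  by_contra! hcon
  replace hcon : ∀ t > R, (∀ r ∈ Ioc R t, g r ≠ 0) → 0 ≤ Ham a b (f t) (g t) := by
    intro t ht hne
    by_contra! hneg
    obtain ⟨r, hr, hr0⟩ := hcon t ht hneg
    exact hne r hr hr0
  obtain ⟨m, hm, hm2⟩ : ∃ m : ℝ, 0 < m ∧ m ^ 2 = b / (2 * a) :=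
    ⟨√(b / (2 * a)), by positivity, Real.sq_sqrt (by positivity)⟩
  have hsb : 0 < √b := Real.sqrt_pos.2 hb
  have core : ∀ t > R, (∀ r ∈ Ioc R t, 0 < g r) → (∀ r ∈ Ioc R t, g r ≤ m) →
      0 < f t ∧ g t < m ∧ 0 ≤ Ham a b (f t) (g t) := by
    intro t ht hpos hle
    have hH0 : ∀ r ∈ Icc R t, 0 ≤ Ham a b (f r) (g r) := by
      intro r hr
      rcases hr.1.eq_or_lt with h1 | h1
      · rw [← h1, hg]; exact Ham_zero_right_nonneg a b _
      · exact hcon r h1 fun u hu => (hpos u ⟨hu.1, hu.2.trans hr.2⟩).ne'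
    have hsm : ∀ r ∈ Icc R t, (g r) ^ 2 ≤ b / (2 * a) := by
      intro r hr
      rcases hr.1.eq_or_lt with h1 | h1
      · rw [← h1, hg, zero_pow two_ne_zero]; positivity
      · rw [← hm2]
        exact pow_le_pow_left₀ (hpos r ⟨h1, hr.2⟩).le (hle r ⟨h1, hr.2⟩) 2
    have hfpos : ∀ r ∈ Icc R t, 0 < f r := by
      intro r hr
      refine pos_of_forall_ne_zero hr.1 (h.contOn_f le_rfl) hf fun u hu hu0 => ?_
      rcases hu.1.eq_or_lt with h1 | h1
      · rw [← h1] at hu0; exact hf.ne' hu0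
      · have hu' : u ∈ Icc R t := ⟨hu.1, hu.2.trans hr.2⟩
        have h2 := le_sq_of_Ham_nonneg' hb hab (hsm u hu') (hH0 u hu')
        have h3 := hpos u ⟨h1, hu'.2⟩
        rw [hu0] at h2
        have : 0 < b / 2 * g u ^ 2 := by positivity
        linarith
    refine ⟨hfpos t (right_mem_Icc.2 ht.le), ?_, hH0 t (right_mem_Icc.2 ht.le)⟩
    have h1 := h.mul_Ham_add_sq_antitone hb hab le_rfl ht.le hsm hH hH0
      fun r hr => (hfpos r (Ioo_subset_Icc_self hr)).le
    have h2 := mul_nonneg (h.pos.trans ht).le (hH0 t (right_mem_Icc.2 ht.le))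
    rw [hg] at h1 hRH
    have h3 : √b / 2 * g t ^ 2 < √b / 2 * m ^ 2 := by
      rw [hm2]; linarith
    exact lt_of_pow_lt_pow_left₀ 2 hm.le (lt_of_mul_lt_mul_left h3 (by positivity))
  obtain ⟨d, hd, hd1, -⟩ := sign_near_simple_zero (h.deriv_g R le_rfl)
    (by rw [hg]; simpa using hf) hg
  have hev : ∀ᶠ r in 𝓝 R, g r < m :=
    (h.deriv_g R le_rfl).continuousAt.eventually (eventually_lt_nhds (by rw [hg]; exact hm))
  obtain ⟨e, he, he1⟩ := Metric.eventually_nhds_iff.1 hev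
  obtain ⟨s, hs, hsd, hse⟩ : ∃ s, R < s ∧ s ≤ R + d ∧ s < R + e :=
    ⟨R + min d (e / 2), by have := lt_min hd (half_pos he); linarith,
      by linarith [min_le_left d (e / 2)], by linarith [min_le_right d (e / 2)]⟩
  have hstart : ∀ r, R < r → r ≤ s → 0 < g r ∧ g r < m := fun r hr hr' =>
    ⟨hd1 r hr (hr'.trans hsd), he1 (by rw [Real.dist_eq, abs_lt]; constructor <;> linarith)⟩
  have hcont : ∀ t, ContinuousOn (fun r => g r * (m - g r)) (Icc s t) := fun t =>
    (h.contOn_g hs.le).mul (continuousOn_const.sub (h.contOn_g hs.le))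
  have hs0 := hstart s hs le_rfl
  have hband : ∀ r, 0 < g r * (m - g r) → 0 < g r ∧ g r < m := by
    intro r hr
    constructor
    · by_contra! h1
      nlinarith
    · by_contra! h1
      nlinarith
  by_cases hex : ∃ t, s ≤ t ∧ g t * (m - g t) ≤ 0
  · obtain ⟨t, hst, ht⟩ := hex
    obtain ⟨z, hz, hz0, hz1⟩ := exists_first_zero hst (hcont t)
      (mul_pos hs0.1 (sub_pos.2 hs0.2)) ht
    have hb1 : ∀ r, R < r → r < z → 0 < g r ∧ g r < m := by
      intro r hr hrz
      rcases le_total r s with h1 | h1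
      · exact hstart r hr h1
      · exact hband r (hz1 r ⟨h1, hrz⟩)
    have hgz : g s ≤ g z := by
      refine le_of_hasDerivAt_nonneg hz.1.le (h.contOn_g hs.le)
        (fun r hr => h.deriv_g r (hs.le.trans hr.1.le)) fun r hr => ?_
      have h1 := (core r (hs.trans hr.1)
        (fun u hu => (hb1 u hu.1 (hu.2.trans_lt hr.2)).1)
        (fun u hu => (hb1 u hu.1 (hu.2.trans_lt hr.2)).2.le)).1
      have h2 := h.lt_one r (hs.le.trans hr.1.le)
      exact mul_nonneg h1.le (by linarith)
    have hgz0 : 0 < g z := hs0.1.trans_le hgz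
    have hgzm : g z = m := by
      rcases mul_eq_zero.1 hz0 with h1 | h1
      · exact absurd h1 hgz0.ne'
      · linarith
    have hle : ∀ r ∈ Ioc R z, 0 < g r ∧ g r ≤ m := by
      intro r hr
      rcases hr.2.eq_or_lt with h1 | h1
      · rw [h1]; exact ⟨hgz0, hgzm.le⟩
      · exact ⟨(hb1 r hr.1 h1).1, (hb1 r hr.1 h1).2.le⟩
    have := (core z (hs.trans hz.1) (fun r hr => (hle r hr).1) fun r hr => (hle r hr).2).2.1
    exact this.ne hgzm
  · push Not at hex
    have hb1 : ∀ r, R < r → 0 < g r ∧ g r < m := by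
      intro r hr
      rcases le_total r s with h1 | h1
      · exact hstart r hr h1
      · exact hband r (hex r h1)
    have hcore : ∀ t > R, 0 < f t ∧ g t < m ∧ 0 ≤ Ham a b (f t) (g t) := fun t ht =>
      core t ht (fun u hu => (hb1 u hu.1).1) fun u hu => (hb1 u hu.1).2.le
    have hmono : ∀ t, s ≤ t → g s ≤ g t := by
      intro t hst
      refine le_of_hasDerivAt_nonneg hst (h.contOn_g hs.le)
        (fun r hr => h.deriv_g r (hs.le.trans hr.1.le)) fun r hr => ?_
      have h2 := h.lt_one r (hs.le.trans hr.1.le)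
      exact mul_nonneg (hcore r (hs.trans hr.1)).1.le (by linarith)
    obtain ⟨c, hc, hc2⟩ : ∃ c : ℝ, 0 < c ∧ c ^ 2 = b / 2 * g s ^ 2 :=
      ⟨√(b / 2 * g s ^ 2), Real.sqrt_pos.2 (mul_pos (by positivity) (pow_pos hs0.1 2)),
        Real.sq_sqrt (by positivity)⟩
    have hm34 : m ^ 2 ≤ 1 / 4 := by
      rw [hm2, div_le_iff₀ (by positivity)]; linarith
    have hgrow : ∀ t, s ≤ t → g s - 3 / 4 * c * s ≤ g t - 3 / 4 * c * t := by
      intro t hst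
      refine le_of_hasDerivAt_nonneg (u := fun r => g r - 3 / 4 * c * r)
        (u' := fun r => f r * (1 - g r ^ 2) - 3 / 4 * c) hst
        ((h.contOn_g hs.le).sub (by fun_prop))
        (fun r hr => ((h.deriv_g r (hs.le.trans hr.1.le)).sub
          ((hasDerivAt_id r).const_mul (3 / 4 * c))).congr_deriv (by simp)) fun r hr => ?_
      have hr0 := hs.trans hr.1
      obtain ⟨k1, k2, k3⟩ := hcore r hr0
      have k4 := (hb1 r hr0).1
      have k5 : g r ^ 2 ≤ m ^ 2 := pow_le_pow_left₀ k4.le k2.le 2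
      have k6 := le_sq_of_Ham_nonneg' hb hab (hm2 ▸ k5) k3
      have k7 : g s ^ 2 ≤ g r ^ 2 := pow_le_pow_left₀ hs0.1.le (hmono r hr.1.le) 2
      have k8 : c ≤ f r := by
        refine le_of_abs_le (abs_le_of_sq_le_sq ?_ k1.le)
        rw [hc2]; nlinarith
      nlinarith
    have h1 := hgrow (s + m / (3 / 4 * c)) (by have : 0 < m / (3 / 4 * c) := by positivity
                                               linarith)
    have h2 := (hb1 (s + m / (3 / 4 * c)) (by have : 0 < m / (3 / 4 * c) := by positivity
                                              linarith)).2
    have h3 : 3 / 4 * c * (s + m / (3 / 4 * c)) = 3 / 4 * c * s + m := by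
      field_simp
    rw [h3] at h1
    linarith [hs0.1]

lemma exists_Ham_neg (h : DampedSol a b R ψ f g) (hb : 0 < b) (hab : 2 * b < a)
    (hg : g R = 0) (hf : f R ≠ 0) (hH : Ham a b (f R) (g R) ≤ a / 8)
    (hRH : R * Ham a b (f R) (g R) < √b / 2 * (b / (2 * a))) :
    ∃ t > R, Ham a b (f t) (g t) < 0 ∧ ∀ r ∈ Ioc R t, g r ≠ 0 := by
  rcases hf.lt_or_gt with h1 | h1
  · obtain ⟨t, ht, ht1, ht2⟩ := h.neg.exists_Ham_neg_of_pos hb hab (by simpa using hg)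
      (by simpa using h1) (by simpa only [Ham_neg] using hH) (by simpa only [Ham_neg] using hRH)
    exact ⟨t, ht, by simpa only [Ham_neg] using ht1, by simpa using ht2⟩
  · exact h.exists_Ham_neg_of_pos hb hab hg h1 hH hRH

lemma decreasing_of_Ham_nonneg (h : DampedSol a b R ψ f g) (hb : 0 < b) (hab : 2 * b < a)
    (hf : f R < 0) (hg2 : g R ^ 2 ≤ b / (2 * a)) {T : ℝ}
    (hpos : ∀ r ∈ Ico R T, 0 < g r) (hH0 : ∀ r ∈ Ico R T, 0 ≤ Ham a b (f r) (g r)) :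
    ∀ r ∈ Ico R T, f r < 0 ∧ g r ≤ g R := by
  have ha : 0 < a := by linarith
  have hmono : ∀ t, R ≤ t → (∀ r ∈ Ioo R t, f r < 0) → g t ≤ g R := by
    intro t ht hlt
    refine le_of_hasDerivAt_nonpos ht (h.contOn_g le_rfl)
      (fun r hr => h.deriv_g r hr.1.le) fun r hr => ?_
    have h2 := h.lt_one r hr.1.le
    exact mul_nonpos_of_nonpos_of_nonneg (hlt r hr).le (by linarith)
  have hneg : ∀ r ∈ Ico R T, f r < 0 := by
    intro r hr
    by_contra! hr0
    obtain ⟨z, hz, hz0, hz1⟩ := exists_first_zero (h := fun r => -f r) hr.1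
      (h.contOn_f le_rfl).neg (by simpa using hf) (by simpa using hr0)
    have hz0' : f z = 0 := by simpa using hz0
    have hzT : z ∈ Ico R T := ⟨hz.1.le, hz.2.trans_lt hr.2⟩
    have h1 := hmono z hz.1.le fun u hu => by simpa using hz1 u ⟨hu.1.le, hu.2⟩
    have h2 := hpos z hzT
    have h3 : g z ^ 2 ≤ b / (2 * a) := (pow_le_pow_left₀ h2.le h1 2).trans hg2
    have h4 := le_sq_of_Ham_nonneg' hb hab h3 (hH0 z hzT)
    rw [hz0'] at h4
    have : 0 < b / 2 * g z ^ 2 := by positivity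
    linarith
  exact fun r hr => ⟨hneg r hr, hmono r hr.1 fun u hu => hneg u ⟨hu.1.le, hu.2.trans hr.2⟩⟩

lemma tendsto_zero_of_Ham_nonneg (h : DampedSol a b R ψ f g) (hb : 0 < b) (hab : 2 * b < a)
    (hf : f R < 0) (hg2 : g R ^ 2 ≤ b / (2 * a)) (hH : Ham a b (f R) (g R) ≤ a / 8)
    (hpos : ∀ r, R ≤ r → 0 < g r) (hH0 : ∀ r, R ≤ r → 0 ≤ Ham a b (f r) (g r)) :
    Tendsto (fun r => (f r, g r)) atTop (𝓝 ((0 : ℝ), (0 : ℝ))) := by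
  have ha : 0 < a := by linarith
  have hdec : ∀ r, R ≤ r → f r < 0 ∧ g r ≤ g R := fun r hr =>
    h.decreasing_of_Ham_nonneg hb hab hf hg2 (T := r + 1) (fun u hu => hpos u hu.1)
      (fun u hu => hH0 u hu.1) r ⟨hr, by linarith⟩
  have hsm : ∀ r, R ≤ r → g r ^ 2 ≤ b / (2 * a) := fun r hr =>
    (pow_le_pow_left₀ (hpos r hr).le (hdec r hr).2 2).trans hg2
  have hquart : ∀ r, R ≤ r → g r ^ 2 ≤ 1 / 4 := fun r hr => (hsm r hr).trans (by
    rw [div_le_iff₀ (by positivity)]; linarith)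
  have hHlim : Tendsto (fun r => Ham a b (f r) (g r)) atTop (𝓝 0) := by
    refine tendsto_of_tendsto_of_tendsto_of_le_of_le' tendsto_const_nhds
      (tendsto_const_nhds.div_atTop tendsto_id : Tendsto
        (fun r : ℝ => R * Ham a b (f R) (g R) / r) atTop (𝓝 0)) ?_ ?_
    · filter_upwards [eventually_ge_atTop R] with r hr using hH0 r hr
    · filter_upwards [eventually_ge_atTop R] with r hr
      rw [le_div_iff₀ (h.pos.trans_le hr), mul_comm]
      exact h.mul_Ham_antitone hb hab le_rfl hr (fun u hu => hsm u hu.1) hH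
  obtain ⟨c, hc, hc2⟩ : ∃ c : ℝ, 0 < c ∧ c ^ 2 = b / 2 :=
    ⟨√(b / 2), by positivity, Real.sq_sqrt (by positivity)⟩
  have hgexp : ∀ r, R ≤ r → g r * exp (3 / 4 * c * r) ≤ g R * exp (3 / 4 * c * R) := by
    intro r hr
    have hd : ∀ u, R ≤ u → HasDerivAt (fun u => g u * exp (3 / 4 * c * u))
        (f u * (1 - g u ^ 2) * exp (3 / 4 * c * u)
          + g u * (exp (3 / 4 * c * u) * (3 / 4 * c))) u := fun u hu => by
      have he : HasDerivAt (fun u => 3 / 4 * c * u) (3 / 4 * c) u := by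
        simpa using (hasDerivAt_id u).const_mul (3 / 4 * c)
      exact (h.deriv_g u hu).mul he.exp
    refine le_of_hasDerivAt_nonpos (u := fun u => g u * exp (3 / 4 * c * u)) hr
      (fun u hu => (hd u hu.1).continuousAt.continuousWithinAt) (fun u hu => hd u hu.1.le)
      fun u hu => ?_
    have hu' := hu.1.le
    have k1 := le_sq_of_Ham_nonneg' hb hab (hsm u hu') (hH0 u hu')
    have k2 := (hdec u hu').1
    have k3 := hpos u hu'
    have k4 : c * g u ≤ -f u := by
      refine le_of_abs_le (abs_le_of_sq_le_sq ?_ (by linarith))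
      rw [mul_pow, hc2]; linarith
    have k5 := hquart u hu'
    have k6 : f u * (1 - g u ^ 2) + g u * (3 / 4 * c) ≤ 0 := by nlinarith
    have k7 := exp_pos (3 / 4 * c * u)
    nlinarith
  have hglim : Tendsto g atTop (𝓝 0) := by
    have hexp : Tendsto (fun r : ℝ => exp (3 / 4 * c * r)) atTop atTop :=
      tendsto_exp_atTop.comp (tendsto_id.const_mul_atTop (by positivity))
    refine tendsto_of_tendsto_of_tendsto_of_le_of_le' tendsto_const_nhds
      (tendsto_const_nhds.div_atTop hexp : Tendsto
        (fun r : ℝ => g R * exp (3 / 4 * c * R) / exp (3 / 4 * c * r)) atTop (𝓝 0)) ?_ ?_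
    · filter_upwards [eventually_ge_atTop R] with r hr using (hpos r hr).le
    · filter_upwards [eventually_ge_atTop R] with r hr
      rw [le_div_iff₀ (exp_pos _)]
      exact hgexp r hr
  have hf2lim : Tendsto (fun r => f r ^ 2) atTop (𝓝 0) := by
    have hub : Tendsto (fun r => 4 / 3 * (2 * Ham a b (f r) (g r) + b * g r ^ 2)) atTop (𝓝 0) := by
      simpa using ((hHlim.const_mul 2).add ((hglim.pow 2).const_mul b)).const_mul (4 / 3)
    refine tendsto_of_tendsto_of_tendsto_of_le_of_le' tendsto_const_nhds hub ?_ ?_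
    · exact Eventually.of_forall fun r => sq_nonneg _
    · filter_upwards [eventually_ge_atTop R] with r hr
      have k5 := hquart r hr
      unfold Ham
      nlinarith [sq_nonneg (f r), sq_nonneg (g r ^ 2)]
  have hflim : Tendsto f atTop (𝓝 0) := by
    rw [tendsto_zero_iff_abs_tendsto_zero]
    have := (continuous_sqrt.tendsto 0).comp hf2lim
    simpa [Function.comp_def, Real.sqrt_sq_eq_abs] using this
  exact hflim.prodMk_nhds hglim

lemma trapping_of_pos (h : DampedSol a b R ψ f g) (hb : 0 < b) (hab : 2 * b < a)
    (hnz : ∀ r, R ≤ r → g r = 0 → f r ≠ 0)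
    (hf : f R < 0) (hg : 0 < g R) (hg2 : g R ^ 2 ≤ b / (2 * a))
    (hH : Ham a b (f R) (g R) ≤ a / 8)
    (hRH : R * Ham a b (f R) (g R) < √b / 2 * (b / (2 * a))) :
    ((∀ r, R ≤ r → g r ≠ 0) ∧
      (Tendsto (fun r => (f r, g r)) atTop (𝓝 ((0 : ℝ), (0 : ℝ))) ∨
        ∃ L, L < 0 ∧ Tendsto (fun r => Ham a b (f r) (g r)) atTop (𝓝 L))) ∨
    ((∃ z, R ≤ z ∧ ∀ r, R ≤ r → (g r = 0 ↔ r = z)) ∧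
      ∃ L, L < 0 ∧ Tendsto (fun r => Ham a b (f r) (g r)) atTop (𝓝 L)) := by
  have ha : 0 < a := by linarith
  by_cases hzero : ∃ t, R ≤ t ∧ g t = 0
  · right
    obtain ⟨t, hRt, ht⟩ := hzero
    obtain ⟨z, hz, hz0, hz1⟩ := exists_first_zero hRt (h.contOn_g le_rfl) hg ht.le
    have hHz : 0 ≤ Ham a b (f z) (g z) := by rw [hz0]; exact Ham_zero_right_nonneg a b _
    have hdec := h.decreasing_of_Ham_nonneg hb hab hf hg2 hz1
      fun r hr => hHz.trans (h.Ham_antitone hr.1 hr.2.le)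
    have hsm : ∀ r ∈ Icc R z, g r ^ 2 ≤ b / (2 * a) := by
      intro r hr
      rcases hr.2.eq_or_lt with h1 | h1
      · rw [h1, hz0, zero_pow two_ne_zero]; positivity
      · exact (pow_le_pow_left₀ (hz1 r ⟨hr.1, h1⟩).le (hdec r ⟨hr.1, h1⟩).2 2).trans hg2
    obtain ⟨s, hs, hs1, hs2⟩ := (h.mono hz.1.le).exists_Ham_neg hb hab hz0
      (hnz z hz.1.le hz0) ((h.Ham_antitone le_rfl hz.1.le).trans hH)
      ((h.mul_Ham_antitone hb hab le_rfl hz.1.le hsm hH).trans_lt hRH)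
    have hRs : R ≤ s := hz.1.le.trans hs.le
    refine ⟨⟨z, hz.1.le, fun r hr => ⟨fun hr0 => ?_, fun hr0 => hr0 ▸ hz0⟩⟩,
      h.tendsto_Ham_neg ha hb hRs hs1⟩
    rcases lt_trichotomy r z with h1 | h1 | h1
    · exact absurd hr0 (hz1 r ⟨hr, h1⟩).ne'
    · exact h1
    · rcases le_total r s with h2 | h2
      · exact absurd hr0 (hs2 r ⟨h1, h2⟩)
      · exact absurd hr0 (h.ne_zero_of_Ham_neg hRs hs1 h2)
  · left
    push Not at hzero
    refine ⟨hzero, ?_⟩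
    by_cases hex : ∃ t, R ≤ t ∧ Ham a b (f t) (g t) < 0
    · obtain ⟨t, ht, ht1⟩ := hex
      exact Or.inr (h.tendsto_Ham_neg ha hb ht ht1)
    · push Not at hex
      exact Or.inl (h.tendsto_zero_of_Ham_nonneg hb hab hf hg2 hH (fun r hr =>
        pos_of_forall_ne_zero hr (h.contOn_g le_rfl) hg fun u hu => hzero u hu.1) hex)

/-- A solution approaching the origin with little energy either converges to it, or falls into a
well after at most one more sign change of `g`. -/
lemma trapping (h : DampedSol a b R ψ f g) (hb : 0 < b) (hab : 2 * b < a)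
    (hnz : ∀ r, R ≤ r → g r = 0 → f r ≠ 0)
    (hfg : f R * g R < 0) (hg2 : g R ^ 2 ≤ b / (2 * a))
    (hH : Ham a b (f R) (g R) ≤ a / 8)
    (hRH : R * Ham a b (f R) (g R) < √b / 2 * (b / (2 * a))) :
    ((∀ r, R ≤ r → g r ≠ 0) ∧
      (Tendsto (fun r => (f r, g r)) atTop (𝓝 ((0 : ℝ), (0 : ℝ))) ∨
        ∃ L, L < 0 ∧ Tendsto (fun r => Ham a b (f r) (g r)) atTop (𝓝 L))) ∨
    ((∃ z, R ≤ z ∧ ∀ r, R ≤ r → (g r = 0 ↔ r = z)) ∧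
      ∃ L, L < 0 ∧ Tendsto (fun r => Ham a b (f r) (g r)) atTop (𝓝 L)) := by
  rcases mul_neg_iff.1 hfg with ⟨h1, h2⟩ | ⟨h1, h2⟩
  · have key := h.neg.trapping_of_pos hb hab (by simpa using hnz) (by simpa using h1)
      (by simpa using h2) (by simpa using hg2) (by simpa only [Ham_neg] using hH)
      (by simpa only [Ham_neg] using hRH)
    simp only [Ham_neg, neg_eq_zero, ne_eq] at key
    refine key.imp_left fun ⟨k1, k2⟩ => ⟨k1, k2.imp_left fun k3 => ?_⟩
    simpa using k3.neg
  · exact h.trapping_of_pos hb hab hnz h1 h2 hg2 hH hRH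

end DampedSol

/-! ### Regularized solutions -/

lemma IsCutoff.eq_one {a b η : ℝ} {φ : ℝ → ℝ → ℝ} (hφ : IsCutoff a b η φ)
    (hη : η < √(a - b) - √(a / 2)) {p q : ℝ} (hp : p ^ 2 ≤ a / 2) : φ p q = 1 := by
  refine hφ.2.2.2.2 p q ?_
  have := Real.abs_le_sqrt hp
  linarith

namespace IsRegSolOn

variable {a b η y : ℝ} {φ : ℝ → ℝ → ℝ} {f g : ℝ → ℝ}

lemma contOn_f (h : IsRegSolOn a b φ y f g (Ici 0)) {s t : ℝ} (hs : 0 ≤ s) :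
    ContinuousOn f (Icc s t) := h.2.2.1.mono fun _ hr => hs.trans hr.1

lemma contOn_g (h : IsRegSolOn a b φ y f g (Ici 0)) {s t : ℝ} (hs : 0 ≤ s) :
    ContinuousOn g (Icc s t) := h.2.2.2.1.mono fun _ hr => hs.trans hr.1

lemma deriv_f (h : IsRegSolOn a b φ y f g (Ici 0)) {r : ℝ} (hr : 0 < r) :
    HasDerivAt f (g r * ((f r) ^ 2 - a * (g r) ^ 2 + b) - 2 * φ (f r) (g r) / r * f r) r :=
  (h.2.2.2.2 r hr.le hr).1

lemma deriv_g (h : IsRegSolOn a b φ y f g (Ici 0)) {r : ℝ} (hr : 0 < r) :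
    HasDerivAt g (f r * (1 - (g r) ^ 2)) r :=
  (h.2.2.2.2 r hr.le hr).2

lemma sq_lt_one (h : IsRegSolOn a b φ y f g (Ici 0)) (hy : y ∈ Ioo (0 : ℝ) 1) {r : ℝ}
    (hr : 0 ≤ r) : (g r) ^ 2 < 1 := by
  obtain ⟨C, hC⟩ := (isCompact_Icc (a := (0 : ℝ)) (b := r)).exists_bound_of_continuousOn
    ((h.contOn_f le_rfl).mul (h.contOn_g le_rfl))
  have hw0 : 0 < 1 - g 0 ^ 2 := by rw [h.2.1]; nlinarith [hy.1, hy.2]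
  have hcg : ContinuousOn (fun t => 1 - g t ^ 2) (Icc 0 r) :=
    continuousOn_const.sub ((h.contOn_g le_rfl).pow 2)
  have key := pos_of_forall_ne_zero hr hcg hw0 fun t ht ht0 => by
    have hmono := le_of_hasDerivAt_nonneg
      (u := fun t => (1 - g t ^ 2) ^ 2 * exp (4 * C * t))
      (u' := fun t => (4 * C - 4 * (f t * g t)) * (1 - g t ^ 2) ^ 2 * exp (4 * C * t)) ht.1
      (((hcg.mono (Icc_subset_Icc_right ht.2)).pow 2).mul (by fun_prop))
      (fun u hu => by
        have he : HasDerivAt (fun u => 4 * C * u) (4 * C) u := by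
          simpa using (hasDerivAt_id u).const_mul (4 * C)
        refine (((((h.deriv_g hu.1).pow 2).const_sub 1).pow 2).mul he.exp).congr_deriv ?_
        simp only [Pi.pow_apply]
        push_cast
        ring)
      (fun u hu => by
        have h1 := le_of_abs_le (hC u ⟨hu.1.le, hu.2.le.trans ht.2⟩)
        simp only [Pi.mul_apply] at h1
        have h2 : 0 ≤ 4 * C - 4 * (f u * g u) := by linarith
        positivity)
    simp only [ht0, mul_zero, exp_zero, mul_one] at hmono
    have : 0 < (1 - g 0 ^ 2) ^ 2 := by positivity
    linarith
  linarith

lemma dampedSol (h : IsRegSolOn a b φ y f g (Ici 0)) (hφ : IsCutoff a b η φ)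
    (hη : η < √(a - b) - √(a / 2)) (hy : y ∈ Ioo (0 : ℝ) 1) {R : ℝ} (hR : 0 < R) :
    DampedSol a b R (fun r => φ (f r) (g r)) f g where
  pos := hR
  deriv_f _ hr := h.deriv_f (hR.trans_le hr)
  deriv_g _ hr := h.deriv_g (hR.trans_le hr)
  nonneg _ _ := (hφ.1 _ _).1
  eq_one _ _ hr := hφ.eq_one hη hr
  lt_one _ hr := h.sq_lt_one hy (hR.le.trans hr)

lemma Ham_le (h : IsRegSolOn a b φ y f g (Ici 0)) (hφ : IsCutoff a b η φ)
    (hη : η < √(a - b) - √(a / 2)) (hy : y ∈ Ioo (0 : ℝ) 1) {r : ℝ} (hr : 0 ≤ r) :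
    Ham a b (f r) (g r) ≤ Ham a b 0 y := by
  have hc : ContinuousOn (fun r => Ham a b (f r) (g r)) (Icc 0 r) :=
    (continuous_Ham a b).comp_continuousOn'
      (f := fun r => (f r, g r)) ((h.contOn_f le_rfl).prodMk (h.contOn_g le_rfl))
  have key := le_of_hasDerivAt_nonpos hr hc
    (fun t ht => (h.dampedSol hφ hη hy ht.1).hasDerivAt_Ham le_rfl) fun t ht => by
      have h1 := (hφ.1 (f t) (g t)).1
      have h2 : 0 ≤ 1 - g t ^ 2 := by linarith [h.sq_lt_one hy ht.1.le]
      have h3 := ht.1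
      have : 0 ≤ 2 * φ (f t) (g t) / t * ((f t) ^ 2 * (1 - (g t) ^ 2)) := by positivity
      linarith
  simpa only [h.1, h.2.1] using key

lemma sq_le (h : IsRegSolOn a b φ y f g (Ici 0)) (hφ : IsCutoff a b η φ)
    (hη : η < √(a - b) - √(a / 2)) (hb : 0 < b) (hab : 2 * b < a) (hy : y ∈ Ioo (0 : ℝ) 1) {r : ℝ}
    (hr : 0 ≤ r) : (f r) ^ 2 ≤ (a - b) - (1 - y ^ 2) * (a - 2 * b) / 2 := by
  have hH := h.Ham_le hφ hη hy hr
  unfold Ham at hH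
  have h1 := h.sq_lt_one hy hr
  have hy2 : 0 < 1 - y ^ 2 := by nlinarith [hy.1, hy.2]
  set d := (1 - y ^ 2) * (a - 2 * b) with hd
  have hd0 : 0 ≤ d := mul_nonneg hy2.le (by linarith)
  have h2 : (1 - g r ^ 2) * (2 * f r ^ 2 - a * g r ^ 2 - (a - 2 * b)) ≤ -d := by
    have : 0 ≤ (1 - y ^ 2) * (a * y ^ 2) :=
      mul_nonneg hy2.le (mul_nonneg (by linarith) (sq_nonneg y))
    nlinarith
  have h3 : 2 * f r ^ 2 - a * g r ^ 2 - (a - 2 * b) ≤ -d := by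
    by_contra! h4
    have h5 : 0 < 1 - g r ^ 2 := by linarith
    nlinarith [mul_pos h5 (sub_pos.2 h4), mul_nonneg hd0 (sq_nonneg (g r))]
  nlinarith

lemma sq_le_mul (h : IsRegSolOn a b φ y f g (Ici 0)) (hφ : IsCutoff a b η φ)
    (hη : η < √(a - b) - √(a / 2)) (hb : 0 < b) (hab : 2 * b < a) (hy : y ∈ Ioo (0 : ℝ) 1) {r : ℝ}
    (hr : 0 ≤ r) : (f r) ^ 2 ≤ 4 * a * (a + 1) * r := by
  have ha : 0 < a := by linarith
  have := le_of_hasDerivAt_nonpos (u := fun r => f r ^ 2 - 4 * a * (a + 1) * r)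
    (u' := fun t => 2 * f t * (g t * ((f t) ^ 2 - a * (g t) ^ 2 + b)
      - 2 * φ (f t) (g t) / t * f t) - 4 * a * (a + 1)) hr
    (((h.contOn_f le_rfl).pow 2).sub (by fun_prop))
    (fun t ht => (((h.deriv_f ht.1).pow 2).sub
      ((hasDerivAt_id t).const_mul (4 * a * (a + 1)))).congr_deriv (by push_cast; ring))
    fun t ht => by
      have h0 := ht.1
      have h1 := (hφ.1 (f t) (g t)).1
      have h2 := h.sq_lt_one hy h0.le
      have h3 : f t ^ 2 ≤ a := by
        have := h.sq_le hφ hη hb hab hy h0.le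
        have : 0 ≤ (1 - y ^ 2) * (a - 2 * b) :=
          mul_nonneg (by nlinarith [hy.1, hy.2]) (by linarith)
        linarith
      have h4 : 0 ≤ 2 * φ (f t) (g t) / t * f t ^ 2 := by positivity
      have h5 : |f t * g t| ≤ (a + 1) / 2 := by
        rw [abs_le]; constructor <;> nlinarith [sq_nonneg (f t + g t), sq_nonneg (f t - g t)]
      have h6 : |(f t) ^ 2 - a * (g t) ^ 2 + b| ≤ 2 * a := by
        rw [abs_le]; constructor <;> nlinarith [sq_nonneg (f t), sq_nonneg (g t)]
      have h7 : f t * g t * ((f t) ^ 2 - a * (g t) ^ 2 + b) ≤ (a + 1) / 2 * (2 * a) :=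
        (le_abs_self _).trans (by rw [abs_mul]; gcongr)
      nlinarith
  simp only [h.1] at this
  linarith

/-- The zeros of `g` are simple. -/
lemma ne_zero (h : IsRegSolOn a b φ y f g (Ici 0)) (hφ : IsCutoff a b η φ)
    (hη : η < √(a - b) - √(a / 2)) (hb : 0 < b) (hab : 2 * b < a) (hy : y ∈ Ioo (0 : ℝ) 1) {r : ℝ}
    (hr : 0 ≤ r) (hg : g r = 0) : f r ≠ 0 := by
  intro hf
  have ha : 0 < a := by linarith
  have hr0 : 0 < r := by
    refine hr.lt_of_ne fun h0 => ?_
    rw [← h0, h.2.1] at hg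
    exact hy.1.ne' hg
  obtain ⟨s, hs, hsg⟩ : ∃ s ∈ Ioo 0 r, 0 < g s := by
    have h1 : Tendsto g (𝓝[>] 0) (𝓝 (g 0)) :=
      (h.2.2.2.1 0 self_mem_Ici).mono Ioi_subset_Ici_self
    have h2 := h1.eventually (eventually_gt_nhds (by rw [h.2.1]; exact hy.1))
    exact ((h2.and (Ioo_mem_nhdsGT hr0)).exists).imp fun s hs => ⟨hs.2, hs.1⟩
  have hs0 := hs.1
  set C := a + 1 + 4 / s with hC
  have := le_of_hasDerivAt_nonneg (u := fun t => (f t ^ 2 + g t ^ 2) * exp (C * t))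
    (u' := fun t => (2 * f t * (g t * ((f t) ^ 2 - a * (g t) ^ 2 + b)
      - 2 * φ (f t) (g t) / t * f t) + 2 * g t * (f t * (1 - g t ^ 2))
      + C * (f t ^ 2 + g t ^ 2)) * exp (C * t)) hs.2.le
    ((((h.contOn_f hs0.le).pow 2).add ((h.contOn_g hs0.le).pow 2)).mul (by fun_prop))
    (fun t ht => by
      have ht0 := hs0.trans ht.1
      have he : HasDerivAt (fun u => C * u) C t := by
        simpa using (hasDerivAt_id t).const_mul C
      refine ((((h.deriv_f ht0).pow 2).add ((h.deriv_g ht0).pow 2)).mul he.exp).congr_deriv ?_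
      simp only [Pi.pow_apply, Pi.add_apply]
      push_cast
      ring)
    fun t ht => by
      have h0 := hs0.trans ht.1
      refine mul_nonneg ?_ (exp_pos _).le
      have h2 := h.sq_lt_one hy h0.le
      have h3 : f t ^ 2 ≤ a - b := by
        have := h.sq_le hφ hη hb hab hy h0.le
        have : 0 ≤ (1 - y ^ 2) * (a - 2 * b) :=
          mul_nonneg (by nlinarith [hy.1, hy.2]) (by linarith)
        linarith
      have h4 : 4 * φ (f t) (g t) / t * f t ^ 2 ≤ 4 / s * f t ^ 2 := by
        have k1 := (hφ.1 (f t) (g t)).2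
        have k2 := ht.1
        gcongr
        linarith
      have h5 : |2 * f t * g t| ≤ f t ^ 2 + g t ^ 2 := by
        rw [abs_le]; constructor <;> nlinarith [sq_nonneg (f t + g t), sq_nonneg (f t - g t)]
      have h6 : |(f t) ^ 2 - a * (g t) ^ 2 + b + (1 - g t ^ 2)| ≤ a + 1 := by
        rw [abs_le]; constructor <;> nlinarith [sq_nonneg (f t), sq_nonneg (g t)]
      have h7 : |2 * f t * g t * ((f t) ^ 2 - a * (g t) ^ 2 + b + (1 - g t ^ 2))|
          ≤ (f t ^ 2 + g t ^ 2) * (a + 1) := by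
        rw [abs_mul]; gcongr
      have h8 := (abs_le.1 h7).1
      have h9 : 0 ≤ 4 / s * g t ^ 2 := by positivity
      have h10 : 2 * f t * (2 * φ (f t) (g t) / t * f t) = 4 * φ (f t) (g t) / t * f t ^ 2 := by
        ring
      rw [hC]
      nlinarith
  simp only [hf, hg] at this
  have h2 : 0 < (f s ^ 2 + g s ^ 2) * exp (C * s) := by positivity
  norm_num at this
  linarith

lemma changesSignAt_iff (h : IsRegSolOn a b φ y f g (Ici 0)) (hφ : IsCutoff a b η φ)
    (hη : η < √(a - b) - √(a / 2)) (hb : 0 < b) (hab : 2 * b < a) (hy : y ∈ Ioo (0 : ℝ) 1)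
    (z : ℝ) : ChangesSignAt g (Ioi 0) z ↔ 0 < z ∧ g z = 0 := by
  constructor
  · rintro ⟨h0, e, he, hsub, -⟩
    exact ⟨hsub (by constructor <;> linarith), h0⟩
  · rintro ⟨hz, h0⟩
    have hd := h.deriv_g hz
    rw [h0] at hd
    refine ⟨h0, ?_⟩
    have hcore : ∃ d > 0, ∀ r, 0 < r → r ≤ d → g (z - r) * g (z + r) < 0 := by
      rcases (h.ne_zero hφ hη hb hab hy hz.le h0).lt_or_gt with h1 | h1
      · obtain ⟨d, hd0, hd1, hd2⟩ := sign_near_simple_zero hd.neg (by simpa using h1)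
          (by simpa using h0)
        refine ⟨d, hd0, fun r hr hrd => ?_⟩
        have k1 := hd1 (z + r) (by linarith) (by linarith)
        have k2 := hd2 (z - r) (by linarith) (by linarith)
        simp only [Pi.neg_apply] at k1 k2
        nlinarith
      · obtain ⟨d, hd0, hd1, hd2⟩ := sign_near_simple_zero hd (by simpa using h1) h0
        exact ⟨d, hd0, fun r hr hrd => mul_neg_of_neg_of_pos
          (hd2 (z - r) (by linarith) (by linarith)) (hd1 (z + r) (by linarith) (by linarith))⟩
    obtain ⟨d, hd0, hd1⟩ := hcore
    have hmin : 0 < min d (z / 2) := lt_min hd0 (by linarith)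
    refine ⟨min d (z / 2), hmin, fun r hr => ?_, hd1 _ hmin (min_le_left _ _), fun r hr => ?_⟩
    · have := min_le_right d (z / 2)
      have := hr.1
      simp only [mem_Ioi]
      linarith
    · exact (hd1 r hr.1 (hr.2.le.trans (min_le_left _ _))).le

end IsRegSolOn

/-! ### Continuous dependence on the initial value -/

lemma ContDiffOn.exists_mul_sub_le_on_box {V : ℝ × ℝ → ℝ} {S : Set (ℝ × ℝ)} {K : ℝ}
    (hV : ContDiffOn ℝ 1 V S) (hS : Icc (-K) K ×ˢ Icc (-1 : ℝ) 1 ⊆ S) :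
    ∃ L : ℝ, 0 ≤ L ∧ ∀ p ∈ Icc (-K) K ×ˢ Icc (-1 : ℝ) 1, ∀ q ∈ Icc (-K) K ×ˢ Icc (-1 : ℝ) 1,
      |(p.1 - q.1) * (V p - V q)| ≤ L * ((p.1 - q.1) ^ 2 + (p.2 - q.2) ^ 2) ∧
      |(p.2 - q.2) * (V p - V q)| ≤ L * ((p.1 - q.1) ^ 2 + (p.2 - q.2) ^ 2) := by
  obtain ⟨L, hL⟩ := (hV.mono hS).exists_lipschitzOnWith one_ne_zero
    ((convex_Icc _ _).prod (convex_Icc _ _)) (isCompact_Icc.prod isCompact_Icc)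
  refine ⟨L, L.2, fun p hp q hq => ?_⟩
  have h1 := hL.dist_le_mul p hp q hq
  rw [Prod.dist_eq, Real.dist_eq, Real.dist_eq, Real.dist_eq] at h1
  have hm : max |p.1 - q.1| |p.2 - q.2| ^ 2 ≤ (p.1 - q.1) ^ 2 + (p.2 - q.2) ^ 2 := by
    rcases max_cases |p.1 - q.1| |p.2 - q.2| with h | h <;> rw [h.1, sq_abs]
    · linarith [sq_nonneg (p.2 - q.2)]
    · linarith [sq_nonneg (p.1 - q.1)]
  have hmain : ∀ s : ℝ, |s| ≤ max |p.1 - q.1| |p.2 - q.2| →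
      |s * (V p - V q)| ≤ L * ((p.1 - q.1) ^ 2 + (p.2 - q.2) ^ 2) := fun s hs => by
    have h0 : 0 ≤ max |p.1 - q.1| |p.2 - q.2| := (abs_nonneg _).trans hs
    calc |s * (V p - V q)| = |s| * |V p - V q| := abs_mul _ _
      _ ≤ max |p.1 - q.1| |p.2 - q.2| * (L * max |p.1 - q.1| |p.2 - q.2|) := by gcongr
      _ = L * max |p.1 - q.1| |p.2 - q.2| ^ 2 := by ring
      _ ≤ _ := by gcongr
  exact ⟨hmain _ (le_max_left _ _), hmain _ (le_max_right _ _)⟩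

lemma IsCutoff.exists_sq_dist_le {a b η : ℝ} {φ : ℝ → ℝ → ℝ} (hφ : IsCutoff a b η φ)
    (hη : η < √(a - b) - √(a / 2)) (hb : 0 < b) (hab : 2 * b < a) {c : ℝ} (hc : c < 1)
    (hc0 : 0 < c) :
    ∃ L : ℝ, ∀ x ∈ Ioc 0 c, ∀ y ∈ Ioc 0 c, ∀ f g p q : ℝ → ℝ,
      IsRegSolOn a b φ x f g (Ici 0) → IsRegSolOn a b φ y p q (Ici 0) →
      ∀ r, 0 ≤ r → (f r - p r) ^ 2 + (g r - q r) ^ 2 ≤ (x - y) ^ 2 * exp (L * r) := by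
  have ha : 0 < a := by linarith
  set K := √((a - b) - (1 - c ^ 2) * (a - 2 * b) / 2) with hK
  have hdc : 0 < (1 - c ^ 2) * (a - 2 * b) := mul_pos (by nlinarith) (by linarith)
  have hKlt : K < √(a - b) := by
    refine Real.sqrt_lt_sqrt ?_ (by linarith)
    nlinarith [sq_nonneg c]
  set S := Ioo (-√(a - b)) √(a - b) ×ˢ (univ : Set ℝ)
  have hS : Icc (-K) K ×ˢ Icc (-1 : ℝ) 1 ⊆ S := fun p hp =>
    ⟨⟨by linarith [hp.1.1], by linarith [hp.1.2]⟩, trivial⟩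
  have hφS : ContDiffOn ℝ 1 (fun p : ℝ × ℝ => φ p.1 p.2) S := hφ.2.1.of_le (by simp)
  obtain ⟨L₁, hL₁, hV₁⟩ := ContDiffOn.exists_mul_sub_le_on_box
    (V := fun p => p.2 * (p.1 ^ 2 - a * p.2 ^ 2 + b))
    (ContDiff.contDiffOn (by fun_prop)) hS
  obtain ⟨L₂, hL₂, hV₂⟩ := ContDiffOn.exists_mul_sub_le_on_box
    (V := fun p => p.1 * (1 - p.2 ^ 2)) (ContDiff.contDiffOn (by fun_prop)) hS
  obtain ⟨L₃, hL₃, hV₃⟩ := ContDiffOn.exists_mul_sub_le_on_box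
    (V := fun p => φ p.1 p.2 * p.1) (hφS.mul contDiffOn_fst) hS
  set ρ := 1 / (8 * (a + 1)) with hρ
  have hρ0 : 0 < ρ := by positivity
  refine ⟨2 * L₁ + 2 * L₂ + 4 * L₃ / ρ, fun x hx y hy f g p q h k r hr => ?_⟩
  have hx' : x ∈ Ioo (0 : ℝ) 1 := ⟨hx.1, hx.2.trans_lt hc⟩
  have hy' : y ∈ Ioo (0 : ℝ) 1 := ⟨hy.1, hy.2.trans_lt hc⟩
  have hbox : ∀ z ∈ Ioc 0 c, ∀ f g : ℝ → ℝ, IsRegSolOn a b φ z f g (Ici 0) → ∀ t, 0 ≤ t →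
      (f t, g t) ∈ Icc (-K) K ×ˢ Icc (-1 : ℝ) 1 := by
    intro z hz f g h t ht
    have hz' : z ∈ Ioo (0 : ℝ) 1 := ⟨hz.1, hz.2.trans_lt hc⟩
    refine ⟨abs_le.1 (Real.abs_le_sqrt ?_), abs_le.1 ((sq_le_one_iff_abs_le_one _).1
      (h.sq_lt_one hz' ht).le)⟩
    have h1 := h.sq_le hφ hη hb hab hz' ht
    have h2 : z ^ 2 ≤ c ^ 2 := pow_le_pow_left₀ hz.1.le hz.2 2
    nlinarith
  have hsmall : ∀ z ∈ Ioc 0 c, ∀ f g : ℝ → ℝ, IsRegSolOn a b φ z f g (Ici 0) → ∀ t, 0 ≤ t →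
      t ≤ ρ → φ (f t) (g t) = 1 := by
    intro z hz f g h t ht htρ
    refine hφ.eq_one hη ((h.sq_le_mul hφ hη hb hab ⟨hz.1, hz.2.trans_lt hc⟩ ht).trans ?_)
    calc 4 * a * (a + 1) * t ≤ 4 * a * (a + 1) * ρ := by gcongr
      _ = a / 2 := by rw [hρ]; field_simp; norm_num
  set L := 2 * L₁ + 2 * L₂ + 4 * L₃ / ρ with hL
  have hmono := le_of_hasDerivAt_nonpos
    (u := fun t => ((f t - p t) ^ 2 + (g t - q t) ^ 2) * exp (-L * t))
    (u' := fun t => (2 * ((f t - p t) * (g t * ((f t) ^ 2 - a * (g t) ^ 2 + b)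
      - q t * ((p t) ^ 2 - a * (q t) ^ 2 + b)))
      - 4 / t * ((f t - p t) * (φ (f t) (g t) * f t - φ (p t) (q t) * p t))
      + 2 * ((g t - q t) * (f t * (1 - g t ^ 2) - p t * (1 - q t ^ 2)))
      - L * ((f t - p t) ^ 2 + (g t - q t) ^ 2)) * exp (-L * t)) hr
    (((((h.contOn_f le_rfl).sub (k.contOn_f le_rfl)).pow 2).add
      (((h.contOn_g le_rfl).sub (k.contOn_g le_rfl)).pow 2)).mul (by fun_prop))
    (fun t ht => by
      have ht0 := ht.1
      have he : HasDerivAt (fun u => -L * u) (-L) t := by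
        simpa using (hasDerivAt_id t).const_mul (-L)
      refine (((((h.deriv_f ht0).sub (k.deriv_f ht0)).pow 2).add
        (((h.deriv_g ht0).sub (k.deriv_g ht0)).pow 2)).mul he.exp).congr_deriv ?_
      simp only [Pi.pow_apply, Pi.add_apply, Pi.sub_apply]
      push_cast
      ring)
    fun t ht => by
      have ht0 := ht.1
      refine mul_nonpos_of_nonpos_of_nonneg ?_ (exp_pos _).le
      have m1 := hbox x hx f g h t ht0.le
      have m2 := hbox y hy p q k t ht0.le
      have e1 := le_of_abs_le (hV₁ _ m1 _ m2).1
      have e2 := le_of_abs_le (hV₂ _ m1 _ m2).2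
      have e3 := (abs_le.1 (hV₃ _ m1 _ m2).1).1
      simp only at e1 e2 e3
      have hE : 0 ≤ (f t - p t) ^ 2 + (g t - q t) ^ 2 := by positivity
      have e4 : -(4 / t * ((f t - p t) * (φ (f t) (g t) * f t - φ (p t) (q t) * p t)))
          ≤ 4 * L₃ / ρ * ((f t - p t) ^ 2 + (g t - q t) ^ 2) := by
        rcases le_total t ρ with h1 | h1
        · rw [hsmall x hx f g h t ht0.le h1, hsmall y hy p q k t ht0.le h1]
          have : 0 ≤ 4 / t * ((f t - p t) ^ 2) := by positivity
          have : 0 ≤ 4 * L₃ / ρ * ((f t - p t) ^ 2 + (g t - q t) ^ 2) := by positivity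
          linarith
        · calc _ = 4 / t * -((f t - p t) * (φ (f t) (g t) * f t - φ (p t) (q t) * p t)) := by ring
            _ ≤ 4 / t * (L₃ * ((f t - p t) ^ 2 + (g t - q t) ^ 2)) := by
              gcongr; linarith
            _ ≤ 4 / ρ * (L₃ * ((f t - p t) ^ 2 + (g t - q t) ^ 2)) := by
              gcongr
            _ = _ := by ring
      rw [hL]
      linarith
  simp only [h.1, k.1, h.2.1, k.2.1, mul_zero, exp_zero, mul_one, sub_self] at hmono
  rw [neg_mul, exp_neg, ← div_eq_mul_inv, div_le_iff₀ (exp_pos _)] at hmono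
  simpa using hmono

/-- Solutions depend continuously on the initial value, uniformly on compact intervals. -/
lemma exists_forall_close {a b η : ℝ} {φ : ℝ → ℝ → ℝ} (hφ : IsCutoff a b η φ)
    (hη : η < √(a - b) - √(a / 2)) (hb : 0 < b) (hab : 2 * b < a) {F G : ℝ → ℝ → ℝ}
    (hFG : ∀ y ∈ Ioo (0 : ℝ) 1, IsRegSolOn a b φ y (F y) (G y) (Ici 0)) {x : ℝ}
    (hx : x ∈ Ioo (0 : ℝ) 1) (R : ℝ) {m : ℝ} (hm : 0 < m) :
    ∃ ε > 0, ∀ y ∈ Ioo (x - ε) (x + ε), y ∈ Ioo (0 : ℝ) 1 ∧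
      ∀ r ∈ Icc 0 R, |F y r - F x r| < m ∧ |G y r - G x r| < m := by
  obtain ⟨hx0, hx1⟩ := hx
  obtain ⟨L, hL⟩ := hφ.exists_sq_dist_le hη hb hab (c := (x + 1) / 2) (by linarith) (by linarith)
  set e := m * exp (-(|L| * R) / 2) with he
  have he0 : 0 < e := by positivity
  set ε := min (min x ((1 - x) / 2)) e with hε
  have hε1 : ε ≤ x := (min_le_left _ _).trans (min_le_left _ _)
  have hε2 : ε ≤ (1 - x) / 2 := (min_le_left _ _).trans (min_le_right _ _)
  have hε3 : ε ≤ e := min_le_right _ _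
  refine ⟨ε, lt_min (lt_min hx0 (by linarith)) he0, fun y hy => ?_⟩
  have hy01 : y ∈ Ioo (0 : ℝ) 1 := ⟨by linarith [hy.1], by linarith [hy.2]⟩
  refine ⟨hy01, fun r hr => ?_⟩
  have h1 := hL y ⟨hy01.1, by linarith [hy.2]⟩ x ⟨hx0, by linarith⟩ _ _ _ _
    (hFG y hy01) (hFG x ⟨hx0, hx1⟩) r hr.1
  have h2 : (y - x) ^ 2 < e ^ 2 := sq_lt_sq' (by linarith [hy.1]) (by linarith [hy.2])
  have h3 : exp (L * r) ≤ exp (|L| * R) := by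
    gcongr
    · exact hr.1
    · exact le_abs_self L
    · exact hr.2
  have h4 : e ^ 2 * exp (|L| * R) = m ^ 2 := by
    rw [he, mul_pow, ← exp_nat_mul, mul_assoc, ← exp_add]
    have : ((2 : ℕ) : ℝ) * (-(|L| * R) / 2) + |L| * R = 0 := by push_cast; ring
    rw [this, exp_zero, mul_one]
  have h5 : (F y r - F x r) ^ 2 + (G y r - G x r) ^ 2 < m ^ 2 := by
    calc _ ≤ (y - x) ^ 2 * exp (L * r) := h1
      _ ≤ (y - x) ^ 2 * exp (|L| * R) := by gcongr
      _ < e ^ 2 * exp (|L| * R) := by gcongr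
      _ = m ^ 2 := h4
  exact ⟨abs_lt_of_sq_lt_sq (by linarith [sq_nonneg (G y r - G x r)]) hm.le,
    abs_lt_of_sq_lt_sq (by linarith [sq_nonneg (F y r - F x r)]) hm.le⟩

/-! ### Stability of the number of zeros -/

lemma mul_pos_of_abs_sub_lt {A B C : ℝ} (h : 0 < A * B) (hC : |C - B| < |B|) : 0 < A * C := by
  rw [abs_lt] at hC
  rcases pos_and_pos_or_neg_and_neg_of_mul_pos h with ⟨h1, h2⟩ | ⟨h1, h2⟩
  · rw [abs_of_pos h2] at hC
    exact mul_pos h1 (by linarith)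
  · rw [abs_of_neg h2] at hC
    exact mul_pos_of_neg_of_neg h1 (by linarith)

namespace IsRegSolOn

variable {a b η : ℝ} {φ : ℝ → ℝ → ℝ}

lemma mul_lt_mul_of_forall_pos {y : ℝ} {p q : ℝ → ℝ} (h : IsRegSolOn a b φ y p q (Ici 0))
    (hy : y ∈ Ioo (0 : ℝ) 1) {A s t : ℝ} (hs : 0 < s) (hst : s < t)
    (hA : ∀ r ∈ Ioo s t, 0 < A * p r) : A * q s < A * q t := by
  refine lt_of_hasDerivAt_pos (u := fun r => A * q r) hst
    (continuousOn_const.mul (h.contOn_g hs.le))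
    (fun r hr => (h.deriv_g (hs.trans hr.1)).const_mul A) fun r hr => ?_
  have h1 := h.sq_lt_one hy (hs.le.trans hr.1.le)
  rw [← mul_assoc]
  exact mul_pos (hA r hr) (by linarith)

lemma eq_of_forall_pos {y : ℝ} {p q : ℝ → ℝ} (h : IsRegSolOn a b φ y p q (Ici 0))
    (hy : y ∈ Ioo (0 : ℝ) 1) {A l u s t : ℝ} (hA : ∀ r ∈ Icc l u, 0 < r ∧ 0 < A * p r)
    (hs : s ∈ Icc l u) (ht : t ∈ Icc l u) (hs0 : q s = 0) (ht0 : q t = 0) : s = t := by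
  by_contra hne
  rcases lt_or_gt_of_ne hne with h1 | h1
  · have := h.mul_lt_mul_of_forall_pos hy (hA s hs).1 h1
      fun r hr => (hA r ⟨hs.1.trans hr.1.le, hr.2.le.trans ht.2⟩).2
    rw [hs0, ht0] at this
    exact this.false
  · have := h.mul_lt_mul_of_forall_pos hy (hA t ht).1 h1
      fun r hr => (hA r ⟨ht.1.trans hr.1.le, hr.2.le.trans hs.2⟩).2
    rw [hs0, ht0] at this
    exact this.false

/-- Solutions close to `(f, g)` on `[0, R]` have the same number of zeros there. -/
lemma exists_ncard_zeros_eq (hφ : IsCutoff a b η φ)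
    (hη : η < √(a - b) - √(a / 2)) (hb : 0 < b) (hab : 2 * b < a) {x : ℝ} {f g : ℝ → ℝ}
    (h : IsRegSolOn a b φ x f g (Ici 0)) (hx : x ∈ Ioo (0 : ℝ) 1) {R : ℝ}
    (hgR : g R ≠ 0) (hfin : {r ∈ Icc 0 R | g r = 0}.Finite) :
    ∃ m > 0, ∀ y ∈ Ioo (0 : ℝ) 1, ∀ p q : ℝ → ℝ, IsRegSolOn a b φ y p q (Ici 0) →
      (∀ r ∈ Icc 0 R, |p r - f r| < m ∧ |q r - g r| < m) →
      {r ∈ Icc 0 R | q r = 0}.Finite ∧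
        {r ∈ Icc 0 R | q r = 0}.ncard = {r ∈ Icc 0 R | g r = 0}.ncard := by
  set S := {r ∈ Icc 0 R | g r = 0} with hS
  have hS0 : ∀ z ∈ S, 0 < z ∧ z < R := by
    intro z hz
    refine ⟨hz.1.1.lt_of_ne fun h0 => ?_, hz.1.2.lt_of_ne fun h0 => hgR (h0 ▸ hz.2)⟩
    have := hz.2
    rw [← h0, h.2.1] at this
    exact hx.1.ne' this
  obtain ⟨δ, hδ, hδ0⟩ : ∃ δ : ℝ, (∀ z ∈ S, ∀ r ∈ Icc (z - δ) (z + δ),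
      r ∈ Ioo 0 R ∧ 0 < f z * f r) ∧ 0 < δ := by
    have hev : ∀ᶠ δ in 𝓝[>] (0 : ℝ), ∀ z ∈ S, ∀ r ∈ Icc (z - δ) (z + δ),
        r ∈ Ioo 0 R ∧ 0 < f z * f r := by
      rw [Filter.eventually_all_finite hfin]
      intro z hz
      obtain ⟨hz0, hzR⟩ := hS0 z hz
      have hfz := h.ne_zero hφ hη hb hab hx hz0.le hz.2
      have h1 : ∀ᶠ r in 𝓝 z, r ∈ Ioo 0 R ∧ 0 < f z * f r :=
        Filter.Eventually.and (Ioo_mem_nhds hz0 hzR) (((h.deriv_f hz0).continuousAt.const_mul (f z)).eventually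
          (eventually_gt_nhds (mul_self_pos.2 hfz)))
      obtain ⟨e, he, he1⟩ := Metric.eventually_nhds_iff.1 h1
      filter_upwards [Ioo_mem_nhdsGT he] with δ hδ r hr
      refine he1 ?_
      rw [Real.dist_eq, abs_lt]
      constructor <;> linarith [hr.1, hr.2, hδ.2]
    exact (hev.and self_mem_nhdsWithin).exists
  have hsep : ∀ z ∈ S, ∀ z' ∈ S, |z' - z| ≤ δ → z = z' := by
    intro z hz z' hz' hzz
    rw [abs_le] at hzz
    exact h.eq_of_forall_pos hx (l := z - δ) (u := z + δ) (A := f z)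
      (fun r hr => ⟨(hδ z hz r hr).1.1, (hδ z hz r hr).2⟩)
      (by constructor <;> linarith) (by constructor <;> linarith) hz.2 hz'.2
  set K := {r ∈ Icc 0 R | ∀ z ∈ S, δ / 2 ≤ |r - z|} with hK
  have hKc : IsCompact K := by
    have : IsClosed {r : ℝ | ∀ z ∈ S, δ / 2 ≤ |r - z|} := by
      simp only [Set.ofPred_forall]
      exact isClosed_biInter fun z _ => isClosed_le continuous_const (by fun_prop)
    exact isCompact_Icc.inter_right this
  obtain ⟨m₁, hm₁, hgm⟩ := hKc.exists_forall_le'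
    (((h.contOn_g le_rfl).abs).mono fun r hr => hr.1) (a := 0) (fun r hr => by
      refine abs_pos.2 fun h0 => ?_
      have := hr.2 r ⟨hr.1, h0⟩
      rw [sub_self, abs_zero] at this
      linarith)
  obtain ⟨m, ⟨hfm, hmm₁⟩, hm⟩ : ∃ m : ℝ, ((∀ z ∈ S, ∀ r ∈ Icc (z - δ) (z + δ), m < |f r|) ∧
      m < m₁) ∧ 0 < m := by
    have hev : ∀ᶠ m in 𝓝[>] (0 : ℝ), ∀ z ∈ S, ∀ r ∈ Icc (z - δ) (z + δ), m < |f r| := by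
      rw [Filter.eventually_all_finite hfin]
      intro z hz
      obtain ⟨m₂, hm₂, hfm₂⟩ := (isCompact_Icc (a := z - δ) (b := z + δ)).exists_forall_le'
        ((h.contOn_f (hδ z hz (z - δ) ⟨le_rfl, by linarith⟩).1.1.le).abs) (a := 0)
        (fun r hr => abs_pos.2 fun h0 => by
          have := (hδ z hz r hr).2
          rw [h0, mul_zero] at this
          exact this.false)
      filter_upwards [Ioo_mem_nhdsGT hm₂] with m hm r hr
      exact hm.2.trans_le (hfm₂ r hr)
    exact ((hev.and (eventually_nhdsWithin_of_eventually_nhds (eventually_lt_nhds hm₁))).and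
      self_mem_nhdsWithin).exists
  refine ⟨m, hm, fun y hy p q k hclose => ?_⟩
  have hp : ∀ z ∈ S, ∀ r ∈ Icc (z - δ) (z + δ), 0 < r ∧ 0 < f z * p r := by
    intro z hz r hr
    obtain ⟨h1, h2⟩ := hδ z hz r hr
    exact ⟨h1.1, mul_pos_of_abs_sub_lt h2
      ((hclose r (Ioo_subset_Icc_self h1)).1.trans (hfm z hz r hr))⟩
  have hend : ∀ z ∈ S, ∀ r, |r - z| = δ / 2 → r ∈ K := by
    intro z hz r hr
    have hr' := abs_le.1 hr.le
    refine ⟨Ioo_subset_Icc_self (hδ z hz r ⟨by linarith, by linarith⟩).1, fun z' hz' => ?_⟩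
    by_contra! hlt
    have : |z' - z| ≤ δ := by
      calc |z' - z| = |(r - z) - (r - z')| := by congr 1; ring
        _ ≤ |r - z| + |r - z'| := abs_sub _ _
        _ ≤ δ := by linarith
    rw [hsep z hz z' hz' this] at hr
    exact hlt.ne hr
  have hex : ∀ z ∈ S, ∃ r ∈ Icc (z - δ / 2) (z + δ / 2), q r = 0 := by
    intro z hz
    have hfz := h.ne_zero hφ hη hb hab hx (hS0 z hz).1.le hz.2
    have hleft : f z * q (z - δ / 2) < 0 := by
      have h1 := h.mul_lt_mul_of_forall_pos hx (A := f z) (s := z - δ / 2) (t := z)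
        (hδ z hz _ ⟨by linarith, by linarith⟩).1.1 (by linarith)
        fun r hr => (hδ z hz r ⟨by linarith [hr.1], by linarith [hr.2]⟩).2
      rw [hz.2, mul_zero] at h1
      have hmem := hend z hz (z - δ / 2) (by
        rw [show z - δ / 2 - z = -(δ / 2) by ring, abs_neg, abs_of_pos (by linarith)])
      have := mul_pos_of_abs_sub_lt (A := -f z) (B := g (z - δ / 2)) (C := q (z - δ / 2))
        (by linarith) ((hclose _ hmem.1).2.trans (hmm₁.trans_le (hgm _ hmem)))
      linarith
    have hright : 0 < f z * q (z + δ / 2) := by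
      have h1 := h.mul_lt_mul_of_forall_pos hx (A := f z) (s := z) (t := z + δ / 2)
        (hS0 z hz).1 (by linarith)
        fun r hr => (hδ z hz r ⟨by linarith [hr.1], by linarith [hr.2]⟩).2
      rw [hz.2, mul_zero] at h1
      have hmem := hend z hz (z + δ / 2) (by
        rw [show z + δ / 2 - z = δ / 2 by ring, abs_of_pos (by linarith)])
      exact mul_pos_of_abs_sub_lt h1
        ((hclose _ hmem.1).2.trans (hmm₁.trans_le (hgm _ hmem)))
    obtain ⟨r, hr, hr0⟩ := intermediate_value_Icc (by linarith)
      (continuousOn_const.mul (k.contOn_g (s := z - δ / 2) (t := z + δ / 2)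
        (hδ z hz _ ⟨by linarith, by linarith⟩).1.1.le)) ⟨hleft.le, hright.le⟩
    exact ⟨r, hr, (mul_eq_zero.1 hr0).resolve_left hfz⟩
  choose! Φ hΦ hΦ0 using hex
  have himage : {r ∈ Icc 0 R | q r = 0} = Set.image Φ S := by
    ext r
    constructor
    · rintro ⟨hr, hr0⟩
      have hnK : r ∉ K := fun hrK => by
        have h1 := (hclose r hr).2
        rw [hr0, zero_sub, abs_neg] at h1
        linarith [hgm r hrK]
      obtain ⟨z, hz, hzr⟩ : ∃ z ∈ S, |r - z| < δ / 2 := by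
        by_contra! hcon
        exact hnK ⟨hr, hcon⟩
      rw [abs_lt] at hzr
      have hΦz := hΦ z hz
      exact ⟨z, hz, k.eq_of_forall_pos hy (hp z hz)
        ⟨by linarith [hΦz.1], by linarith [hΦz.2]⟩ ⟨by linarith, by linarith⟩ (hΦ0 z hz) hr0⟩
    · rintro ⟨z, hz, rfl⟩
      have hΦz := hΦ z hz
      exact ⟨Ioo_subset_Icc_self
        (hδ z hz _ ⟨by linarith [hΦz.1], by linarith [hΦz.2]⟩).1, hΦ0 z hz⟩
  have hinj : InjOn Φ S := by
    intro z hz z' hz' heq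
    have h1 := hΦ z hz
    have h2 := hΦ z' hz'
    rw [← heq] at h2
    exact hsep z hz z' hz' (by
      rw [abs_le]; constructor <;> linarith [h1.1, h1.2, h2.1, h2.2])
  rw [himage]
  exact ⟨hfin.image _, hinj.ncard_image⟩

end IsRegSolOn

namespace IsRegSolOn

variable {a b η x : ℝ} {φ : ℝ → ℝ → ℝ} {f g : ℝ → ℝ}

lemma setOf_changesSignAt (hφ : IsCutoff a b η φ) (hη : η < √(a - b) - √(a / 2)) (hb : 0 < b)
    (hab : 2 * b < a) (h : IsRegSolOn a b φ x f g (Ici 0)) (hx : x ∈ Ioo (0 : ℝ) 1) :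
    {z | ChangesSignAt g (Ioi 0) z} = {z | 0 < z ∧ g z = 0} := by
  ext z
  exact h.changesSignAt_iff hφ hη hb hab hx z

/-- A solution converging to the origin enters the trapping region. -/
lemma exists_mem_trapping_region (hφ : IsCutoff a b η φ) (hη : η < √(a - b) - √(a / 2))
    (hb : 0 < b) (hab : 2 * b < a) (h : IsRegSolOn a b φ x f g (Ici 0)) (hx : x ∈ Ioo (0 : ℝ) 1)
    (hlim : Tendsto (fun r => (f r, g r)) atTop (𝓝 ((0 : ℝ), (0 : ℝ))))
    (hfin : {z | 0 < z ∧ g z = 0}.Finite) :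
    ∃ R > 0, (∀ r, R ≤ r → g r ≠ 0) ∧ f R * g R < 0 ∧ g R ^ 2 < b / (2 * a) ∧
      Ham a b (f R) (g R) < a / 8 ∧ R * Ham a b (f R) (g R) < √b / 2 * (b / (2 * a)) := by
  have ha : 0 < a := by linarith
  have hD : ∀ {R : ℝ}, 0 < R → DampedSol a b R (fun r => φ (f r) (g r)) f g :=
    fun hR => h.dampedSol hφ hη hx hR
  have hH : Tendsto (fun r => Ham a b (f r) (g r)) atTop (𝓝 0) := by
    have h1 := ((continuous_Ham a b).tendsto ((0 : ℝ), (0 : ℝ))).comp hlim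
    simpa [Ham, Function.comp_def] using h1
  have hH0 : ∀ r, 0 < r → 0 ≤ Ham a b (f r) (g r) := fun r hr =>
    le_of_tendsto hH ((eventually_ge_atTop r).mono fun t ht => (hD hr).Ham_antitone le_rfl ht)
  have hg0 : Tendsto g atTop (𝓝 0) := (continuous_snd.tendsto _).comp hlim
  have hg2 : Tendsto (fun r => g r ^ 2) atTop (𝓝 0) := by simpa using hg0.pow 2
  obtain ⟨B, hB⟩ := hfin.bddAbove
  have hev : ∀ᶠ r in atTop, 0 < r ∧ g r ≠ 0 ∧ g r ^ 2 < b / (2 * a) ∧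
      Ham a b (f r) (g r) < a / 8 := by
    filter_upwards [eventually_gt_atTop 0, eventually_gt_atTop B,
      hg2.eventually (eventually_lt_nhds (show 0 < b / (2 * a) by positivity)),
      hH.eventually (eventually_lt_nhds (show 0 < a / 8 by positivity))] with r h1 h2 h3 h4
    exact ⟨h1, fun h0 => (hB ⟨h1, h0⟩).not_gt h2, h3, h4⟩
  obtain ⟨R₁, hR₁⟩ := eventually_atTop.1 hev
  have hR₁0 : 0 < R₁ := (hR₁ R₁ le_rfl).1
  have hdecay : ∀ᶠ r in atTop, r * Ham a b (f r) (g r) < √b / 2 * (b / (2 * a)) := by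
    have h1 : Tendsto (fun r : ℝ => R₁ ^ 2 * Ham a b (f R₁) (g R₁) / r) atTop (𝓝 0) :=
      tendsto_const_nhds.div_atTop tendsto_id
    filter_upwards [eventually_ge_atTop R₁,
      h1.eventually (eventually_lt_nhds (show 0 < √b / 2 * (b / (2 * a)) by positivity))]
      with r hr hlt
    have hr0 : 0 < r := hR₁0.trans_le hr
    have h2 := (hD hR₁0).sq_mul_Ham_antitone hb hab le_rfl hr
      (fun t ht => (hR₁ t ht.1).2.2.1.le) (hR₁ R₁ le_rfl).2.2.2.le
      (fun t ht => hH0 t (hR₁0.trans_le ht.1))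
    refine lt_of_le_of_lt ?_ hlt
    rw [le_div_iff₀ hr0]
    linarith
  obtain ⟨R₂, hR₂⟩ := eventually_atTop.1 (hdecay.and (eventually_ge_atTop R₁))
  have hR₂1 : R₁ ≤ R₂ := (hR₂ R₂ le_rfl).2
  obtain ⟨R, hR, hneg⟩ : ∃ R ≥ R₂, f R * g R < 0 := by
    by_contra! hcon
    have hmono : ∀ t ≥ R₂, g R₂ ^ 2 ≤ g t ^ 2 := fun t ht =>
      le_of_hasDerivAt_nonneg (u := fun r => g r ^ 2) ht
        ((h.contOn_g (hR₁0.le.trans hR₂1)).pow 2)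
        (fun r hr => (h.deriv_g (hR₁0.trans_le (hR₂1.trans hr.1.le))).pow 2) fun r hr => by
          have h1 := h.sq_lt_one hx (hR₁0.le.trans (hR₂1.trans hr.1.le))
          have h2 := mul_nonneg (hcon r hr.1.le) (show 0 ≤ 1 - g r ^ 2 by linarith)
          norm_num
          linarith
    have h1 : g R₂ ^ 2 ≤ 0 := ge_of_tendsto hg2 ((eventually_ge_atTop R₂).mono hmono)
    have h2 := (hR₁ R₂ hR₂1).2.1
    have : 0 < g R₂ ^ 2 := by positivity
    linarith
  have hR1 : R₁ ≤ R := hR₂1.trans hR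
  exact ⟨R, hR₁0.trans_le hR1, fun r hr => (hR₁ r (hR1.trans hr)).2.1, hneg,
    (hR₁ R hR1).2.2.1, (hR₁ R hR1).2.2.2, (hR₂ R hR).1⟩

/-- In the trapping region there is at most one further sign change, and if there is one the
energy becomes negative. -/
lemma changesSignExactly_of_trapping (hφ : IsCutoff a b η φ) (hη : η < √(a - b) - √(a / 2))
    (hb : 0 < b) (hab : 2 * b < a) (h : IsRegSolOn a b φ x f g (Ici 0)) (hx : x ∈ Ioo (0 : ℝ) 1)
    {R : ℝ} (hR : 0 < R) (hfg : f R * g R < 0) (hg2 : g R ^ 2 < b / (2 * a))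
    (hH : Ham a b (f R) (g R) < a / 8)
    (hRH : R * Ham a b (f R) (g R) < √b / 2 * (b / (2 * a))) {k : ℕ}
    (hfin : {r ∈ Icc 0 R | g r = 0}.Finite) (hk : {r ∈ Icc 0 R | g r = 0}.ncard = k) :
    (ChangesSignExactly g (Ioi 0) k ∧
      (Tendsto (fun r => (f r, g r)) atTop (𝓝 ((0 : ℝ), (0 : ℝ))) ∨
        ∃ L, L < 0 ∧ Tendsto (fun r => Ham a b (f r) (g r)) atTop (𝓝 L))) ∨
    (ChangesSignExactly g (Ioi 0) (k + 1) ∧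
      ∃ L, L < 0 ∧ Tendsto (fun r => Ham a b (f r) (g r)) atTop (𝓝 L)) := by
  have hgR : g R ≠ 0 := fun h0 => by simp [h0] at hfg
  have hg0 : g 0 ≠ 0 := by rw [h.2.1]; exact hx.1.ne'
  have hpos : ∀ {r}, 0 ≤ r → g r = 0 → 0 < r := fun hr h0 =>
    hr.lt_of_ne fun he => hg0 (he ▸ h0)
  unfold ChangesSignExactly
  rw [h.setOf_changesSignAt hφ hη hb hab hx]
  rcases (h.dampedSol hφ hη hx hR).trapping hb hab
    (fun r hr => h.ne_zero hφ hη hb hab hx (hR.le.trans hr)) hfg hg2.le hH.le hRH with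
    ⟨hnz, hlim⟩ | ⟨⟨z, hRz, hz⟩, hL⟩
  · have hset : {z | 0 < z ∧ g z = 0} = {r ∈ Icc 0 R | g r = 0} := by
      ext r
      refine ⟨fun hr => ⟨⟨hr.1.le, ?_⟩, hr.2⟩, fun hr => ⟨hpos hr.1.1 hr.2, hr.2⟩⟩
      by_contra! hlt
      exact hnz r hlt.le hr.2
    rw [hset]
    exact Or.inl ⟨⟨hfin, hk⟩, hlim⟩
  · have hgz : g z = 0 := (hz z hRz).2 rfl
    have hset : {z | 0 < z ∧ g z = 0} = insert z {r ∈ Icc 0 R | g r = 0} := by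
      ext r
      constructor
      · intro hr
        rcases le_or_gt r R with h1 | h1
        · exact Or.inr ⟨⟨hr.1.le, h1⟩, hr.2⟩
        · exact Or.inl ((hz r h1.le).1 hr.2)
      · rintro (rfl | hr)
        · exact ⟨hR.trans_le hRz, hgz⟩
        · exact ⟨hpos hr.1.1 hr.2, hr.2⟩
    have hnot : z ∉ {r ∈ Icc 0 R | g r = 0} := fun hmem =>
      hgR (le_antisymm hmem.1.2 hRz ▸ hgz)
    rw [hset]
    exact Or.inr ⟨⟨hfin.insert z, by rw [ncard_insert_of_notMem hnot hfin, hk]⟩, hL⟩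

end IsRegSolOn

/-- Lemma 2.8 (iii): a neighborhood of a point of `I_k` lies in
`A_k ∪ I_k ∪ A_{k+1}`. -/
theorem Ik_trapping (a b η : ℝ) (hb : 0 < b) (hab : 2 * b < a)
    (hη : η ∈ Ioo 0 (Real.sqrt (a - b) - Real.sqrt (a / 2)))
    (φ : ℝ → ℝ → ℝ) (hφ : IsCutoff a b η φ)
    (F G : ℝ → ℝ → ℝ)
    (hFG : ∀ y ∈ Ioo (0 : ℝ) 1, IsRegSolOn a b φ y (F y) (G y) (Ici 0))
    (k : ℕ) (x : ℝ) (hx : x ∈ Iset a b F G k) :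
    ∃ ε > 0, Ioo (x - ε) (x + ε) ⊆ Aset a b F G k ∪ Iset a b F G k ∪ Aset a b F G (k + 1) := by
  obtain ⟨hx01, hlim, hchg⟩ := hx
  have hsol := hFG x hx01
  rw [ChangesSignExactly, hsol.setOf_changesSignAt hφ hη.2 hb hab hx01] at hchg
  obtain ⟨hfin, hcard⟩ := hchg
  obtain ⟨R, hR, hnz, hneg, hg2, hH, hRH⟩ :=
    hsol.exists_mem_trapping_region hφ hη.2 hb hab hx01 hlim hfin
  have hset : {r ∈ Icc 0 R | G x r = 0} = {z | 0 < z ∧ G x z = 0} := by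
    ext r
    refine ⟨fun hr => ⟨hr.1.1.lt_of_ne fun h0 => ?_, hr.2⟩, fun hr => ⟨⟨hr.1.le, ?_⟩, hr.2⟩⟩
    · have h1 := hr.2
      rw [← h0, hsol.2.1] at h1
      exact hx01.1.ne' h1
    · by_contra! hlt
      exact hnz r hlt.le hr.2
  obtain ⟨m₁, hm₁, hcount⟩ := hsol.exists_ncard_zeros_eq hφ hη.2 hb hab hx01 (hnz R le_rfl)
    (hset ▸ hfin)
  have hopen : ∀ᶠ p in 𝓝 (F x R, G x R), p.1 * p.2 < 0 ∧ p.2 ^ 2 < b / (2 * a) ∧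
      Ham a b p.1 p.2 < a / 8 ∧ R * Ham a b p.1 p.2 < √b / 2 * (b / (2 * a)) := by
    have hc := continuous_Ham a b
    refine .and ?_ (.and ?_ (.and ?_ ?_))
    · exact (continuous_fst.mul continuous_snd).continuousAt.eventually_lt continuousAt_const hneg
    · exact (continuous_snd.pow 2).continuousAt.eventually_lt continuousAt_const hg2
    · exact hc.continuousAt.eventually_lt continuousAt_const hH
    · exact (continuous_const.mul hc).continuousAt.eventually_lt continuousAt_const hRH
  obtain ⟨m₂, hm₂, htrap⟩ := Metric.eventually_nhds_iff.1 hopen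
  obtain ⟨ε, hε, hclose⟩ := exists_forall_close hφ hη.2 hb hab hFG hx01 R (lt_min hm₁ hm₂)
  refine ⟨ε, hε, fun y hy => ?_⟩
  obtain ⟨hy01, hy⟩ := hclose y hy
  have hsoly := hFG y hy01
  obtain ⟨hfiny, hcardy⟩ := hcount y hy01 (F y) (G y) hsoly fun r hr =>
    ⟨(hy r hr).1.trans_le (min_le_left _ _), (hy r hr).2.trans_le (min_le_left _ _)⟩
  rw [hset, hcard] at hcardy
  have hyR := hy R ⟨hR.le, le_rfl⟩
  obtain ⟨k1, k2, k3, k4⟩ := htrap (y := (F y R, G y R)) (by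
    rw [Prod.dist_eq, Real.dist_eq, Real.dist_eq]
    exact max_lt (hyR.1.trans_le (min_le_right _ _)) (hyR.2.trans_le (min_le_right _ _)))
  rcases hsoly.changesSignExactly_of_trapping hφ hη.2 hb hab hy01 hR k1 k2 k3 k4 hfiny hcardy with
    ⟨h1, h2 | h2⟩ | ⟨h1, h2⟩
  · exact Or.inl (Or.inr ⟨hy01, h2, h1⟩)
  · exact Or.inl (Or.inl ⟨hy01, h2, h1⟩)
  · exact Or.inr ⟨hy01, h2, h1⟩
end
end
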